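/- Let τ > 1 and let ω ∈ ℝ satisfy inf_{q ≥ 1, q ∈ ℤ} q^τ·‖qω‖ > 0. Let λ ∈ ℂ with 0 < |λ| < 1, let x, y ∈ 𝕋, β, γ ∈ ∂𝔻, and set α_n = λ·e(y + n·x + n(n−1)·ω) for n ∈ ℤ. Then there exists σ > 0 and N₀ such that for every N ≥ N₀ there exist θ_1^N, …, θ_N^N ∈ ℝ and ϑ^N ∈ ℝ with: (1) the eigenvalues (with multiplicity) of the finite CMV matrix ℰ^{[0,N−1]}_{β,γ} are exactly e(θ_1^N), …, e(θ_N^N); and (2) (1/N)·#{ n ∈ {1, …, N} : ‖θ_n^N − ϑ^N + 2nω‖ > N^{−(1+σ)} } ≤ N^{−σ}. -/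

import Mathlib

open scoped ComplexConjugate Matrix

noncomputable section

namespace CMV

/-- `e t = exp(2πi t)`. -/
def e (t : ℝ) : ℂ := Complex.exp (2 * Real.pi * Complex.I * t)

/-- `ρ n = (1 - |α n|^2)^{1/2}`, as a complex number. -/
def rho (α : ℤ → ℂ) (n : ℤ) : ℂ := ((1 - ‖α n‖ ^ 2).sqrt : ℝ)

/-- Entries of the doubly infinite matrix `𝓛 = ⊕_{n even} Θ n`. -/
def cmvL (α : ℤ → ℂ) (i j : ℤ) : ℂ :=
  if Even i ∧ j = i then conj (α i)
  else if Even i ∧ j = i + 1 then rho α i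
  else if Even j ∧ i = j + 1 then rho α j
  else if Odd i ∧ j = i then -α (i - 1)
  else 0

/-- Entries of the doubly infinite matrix `𝓜 = ⊕_{n odd} Θ n`. -/
def cmvM (α : ℤ → ℂ) (i j : ℤ) : ℂ :=
  if Odd i ∧ j = i then conj (α i)
  else if Odd i ∧ j = i + 1 then rho α i
  else if Odd j ∧ i = j + 1 then rho α j
  else if Even i ∧ j = i then -α (i - 1)
  else 0

/-- Coefficients modified at both boundaries: `α̃ (a-1) = β`, `α̃ b = γ`. -/
def modA (α : ℤ → ℂ) (a b : ℤ) (β γ : ℂ) (n : ℤ) : ℂ :=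
  if n = a - 1 then β else if n = b then γ else α n

/-- Coefficients modified only at the left boundary (`•` on the right). -/
def modL (α : ℤ → ℂ) (a : ℤ) (β : ℂ) (n : ℤ) : ℂ :=
  if n = a - 1 then β else α n

/-- Coefficients modified only at the right boundary (`•` on the left). -/
def modR (α : ℤ → ℂ) (b : ℤ) (γ : ℂ) (n : ℤ) : ℂ :=
  if n = b then γ else α n

/-- Principal submatrix of `𝓛` on rows and columns `{a, …, b}`. -/
def subL (αm : ℤ → ℂ) (a b : ℤ) : Matrix (Set.Icc a b) (Set.Icc a b) ℂ :=
  fun i j => cmvL αm i j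

/-- Principal submatrix of `𝓜` on rows and columns `{a, …, b}`. -/
def subM (αm : ℤ → ℂ) (a b : ℤ) : Matrix (Set.Icc a b) (Set.Icc a b) ℂ :=
  fun i j => cmvM αm i j

/-- The finite CMV matrix `ℰ^{[a,b]}`. -/
def cmvE (αm : ℤ → ℂ) (a b : ℤ) : Matrix (Set.Icc a b) (Set.Icc a b) ℂ :=
  subL αm a b * subM αm a b

/-- `φ^{[a,b]}` as a polynomial: the characteristic polynomial of the finite CMV
matrix built from the (modified) coefficients `αm`, normalized by the unmodified
`ρ`'s of `α`. -/
def phiP (α αm : ℤ → ℂ) (a b : ℤ) : Polynomial ℂ :=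
  Polynomial.C (∏ n ∈ Finset.Icc a b, rho α n)⁻¹ * (cmvE αm a b).charpoly

end CMV

open CMV

namespace CMV

/-- The coefficients `∏_{j=1}^n κ / (1 - Q^j)` of the `q`-exponential series. -/
def qexpCoeff (Q κ : ℂ) (n : ℕ) : ℂ := ∏ j ∈ Finset.range n, κ / (1 - Q ^ (j + 1))

theorem qexpCoeff_zero (Q κ : ℂ) : qexpCoeff Q κ 0 = 1 := by simp [qexpCoeff]

theorem qexpCoeff_succ_mul {Q : ℂ} (hQ : ∀ m : ℕ, 1 ≤ m → Q ^ m ≠ 1) (κ : ℂ) (n : ℕ) :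
    qexpCoeff Q κ (n + 1) * (1 - Q ^ (n + 1)) = κ * qexpCoeff Q κ n := by
  have h : 1 - Q ^ (n + 1) ≠ 0 := sub_ne_zero.2 (hQ (n + 1) (by omega)).symm
  rw [qexpCoeff, Finset.prod_range_succ, ← qexpCoeff]
  field_simp

theorem sum_pow_mul_qexpCoeff {Q : ℂ} (hQ : ∀ m : ℕ, 1 ≤ m → Q ^ m ≠ 1) (κ : ℂ) (n : ℕ) :
    ∑ i ∈ Finset.range (n + 1), κ ^ (n + 1 - i) * Q ^ i * qexpCoeff Q κ i
      = κ * qexpCoeff Q κ n := by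
  induction n with
  | zero => simp
  | succ n ih =>
    have h : ∑ i ∈ Finset.range (n + 1), κ ^ (n + 1 + 1 - i) * Q ^ i * qexpCoeff Q κ i
        = κ * ∑ i ∈ Finset.range (n + 1), κ ^ (n + 1 - i) * Q ^ i * qexpCoeff Q κ i := by
      rw [Finset.mul_sum]
      refine Finset.sum_congr rfl fun i hi => ?_
      rw [Nat.sub_add_comm (Finset.mem_range.1 hi).le, pow_succ]
      ring
    rw [Finset.sum_range_succ, h, ih, Nat.add_sub_cancel_left, ← qexpCoeff_succ_mul hQ]
    ring

/-- The recursion obtained from the logarithmic derivative of the `q`-exponential series. -/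
theorem natCast_mul_qexpCoeff {Q : ℂ} (hQ : ∀ m : ℕ, 1 ≤ m → Q ^ m ≠ 1) (κ : ℂ) (n : ℕ) :
    (n : ℂ) * qexpCoeff Q κ n
      = ∑ i ∈ Finset.range n, κ ^ (n - i) / (1 - Q ^ (n - i)) * qexpCoeff Q κ i := by
  induction n with
  | zero => simp
  | succ n ih =>
    have h0 : ∀ m : ℕ, 1 ≤ m → 1 - Q ^ m ≠ 0 := fun m hm => sub_ne_zero.2 (hQ m hm).symm
    have key : (∑ i ∈ Finset.range (n + 1),
          κ ^ (n + 1 - i) / (1 - Q ^ (n + 1 - i)) * qexpCoeff Q κ i) * (1 - Q ^ (n + 1))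
        = ∑ i ∈ Finset.range (n + 1), κ ^ (n + 1 - i) * Q ^ i * qexpCoeff Q κ i
          + ∑ i ∈ Finset.range (n + 1), κ ^ (n + 1 - i) / (1 - Q ^ (n + 1 - i))
            * (qexpCoeff Q κ i * (1 - Q ^ i)) := by
      rw [Finset.sum_mul, ← Finset.sum_add_distrib]
      refine Finset.sum_congr rfl fun i hi => ?_
      have hi' := Finset.mem_range.1 hi
      have hne := h0 (n + 1 - i) (by omega)
      have hp : Q ^ (n + 1) = Q ^ (n + 1 - i) * Q ^ i := by rw [← pow_add]; congr 1; omega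
      rw [hp]
      field_simp
      ring
    have shift : ∑ i ∈ Finset.range (n + 1), κ ^ (n + 1 - i) / (1 - Q ^ (n + 1 - i))
            * (qexpCoeff Q κ i * (1 - Q ^ i)) = κ * (n * qexpCoeff Q κ n) := by
      rw [Finset.sum_range_succ', ih, Finset.mul_sum]
      simp only [pow_zero, sub_self, mul_zero, add_zero]
      refine Finset.sum_congr rfl fun i _ => ?_
      rw [qexpCoeff_succ_mul hQ, Nat.add_sub_add_right]
      ring
    rw [sum_pow_mul_qexpCoeff hQ, shift] at key
    refine mul_right_cancel₀ (h0 (n + 1) (by omega)) ?_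
    rw [key, mul_assoc, qexpCoeff_succ_mul hQ]
    push_cast
    ring

theorem mul_sum_succ_pow_le (K n : ℕ) :
    (K : ℝ) * ∑ i ∈ Finset.range n, ((i : ℝ) + 1) ^ K ≤ n * ((n : ℝ) + 1) ^ K := by
  induction n with
  | zero => simp
  | succ n ih =>
    rw [Finset.sum_range_succ, mul_add]
    have hn : (0 : ℝ) < n + 1 := by positivity
    have hb := one_add_mul_le_pow (a := 1 / ((n : ℝ) + 1)) (by
      have : 0 ≤ 1 / ((n : ℝ) + 1) := by positivity
      linarith) K
    have h2 : ((n : ℝ) + 1 + 1) ^ K = (1 + 1 / ((n : ℝ) + 1)) ^ K * ((n : ℝ) + 1) ^ K := by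
      rw [← mul_pow]; congr 1; field_simp
    push_cast
    rw [h2]
    have h3 : ((n : ℝ) + 1 + K) ≤ (n + 1) * (1 + 1 / ((n : ℝ) + 1)) ^ K := by
      calc ((n : ℝ) + 1 + K) = (n + 1) * (1 + K * (1 / ((n : ℝ) + 1))) := by field_simp
        _ ≤ _ := by gcongr
    nlinarith [pow_pos hn K]

theorem norm_qexpCoeff_le {Q κ : ℂ} (hQ : ∀ m : ℕ, 1 ≤ m → Q ^ m ≠ 1) {s : ℝ} (hs : 0 ≤ s)
    {K : ℕ} (hK : ∀ m : ℕ, 1 ≤ m → ‖κ ^ m / (1 - Q ^ m)‖ ≤ K * s ^ m) (n : ℕ) :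
    ‖qexpCoeff Q κ n‖ ≤ s ^ n * ((n : ℝ) + 1) ^ K := by
  induction n using Nat.strong_induction_on with
  | _ n ih =>
    rcases Nat.eq_zero_or_pos n with rfl | hn
    · simp [qexpCoeff_zero]
    have hn' : (0 : ℝ) < n := by exact_mod_cast hn
    refine le_of_mul_le_mul_left ?_ hn'
    calc (n : ℝ) * ‖qexpCoeff Q κ n‖ = ‖(n : ℂ) * qexpCoeff Q κ n‖ := by simp
      _ ≤ ∑ i ∈ Finset.range n, ‖κ ^ (n - i) / (1 - Q ^ (n - i)) * qexpCoeff Q κ i‖ := by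
        rw [natCast_mul_qexpCoeff hQ]; exact norm_sum_le _ _
      _ ≤ ∑ i ∈ Finset.range n, s ^ n * (K * ((i : ℝ) + 1) ^ K) := by
        refine Finset.sum_le_sum fun i hi => ?_
        have hi' := Finset.mem_range.1 hi
        rw [norm_mul]
        calc _ ≤ (K * s ^ (n - i)) * (s ^ i * ((i : ℝ) + 1) ^ K) := by
              gcongr
              · exact hK _ (by omega)
              · exact ih i hi'
          _ = (s ^ (n - i) * s ^ i) * (K * ((i : ℝ) + 1) ^ K) := by ring
          _ = _ := by rw [← pow_add, Nat.sub_add_cancel hi'.le]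
      _ = s ^ n * (K * ∑ i ∈ Finset.range n, ((i : ℝ) + 1) ^ K) := by
        rw [← Finset.mul_sum, ← Finset.mul_sum]
      _ ≤ s ^ n * (n * ((n : ℝ) + 1) ^ K) :=
        mul_le_mul_of_nonneg_left (mul_sum_succ_pow_le K n) (by positivity)
      _ = _ := by ring

theorem exists_succ_pow_mul_pow_le (K : ℕ) {s r : ℝ} (hs : 0 ≤ s) (hsr : s < r) :
    ∃ C > 0, ∀ n : ℕ, s ^ n * ((n : ℝ) + 1) ^ K ≤ C * r ^ n := by
  have hr : 0 < r := hs.trans_lt hsr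
  have h := tendsto_pow_const_mul_const_pow_of_abs_lt_one K (r := s / r) (by
    rw [abs_of_nonneg (by positivity), div_lt_one hr]; exact hsr)
  obtain ⟨C, hC⟩ := h.bddAbove_range
  rw [mem_upperBounds] at hC
  have hC' : ∀ n : ℕ, (n : ℝ) ^ K * (s / r) ^ n ≤ C := fun n => hC _ ⟨n, rfl⟩
  refine ⟨max (2 ^ K * C) 1, by positivity, fun n => ?_⟩
  rcases Nat.eq_zero_or_pos n with rfl | hn
  · simp
  have h1 : ((n : ℝ) + 1) ^ K ≤ 2 ^ K * (n : ℝ) ^ K := by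
    rw [← mul_pow]
    gcongr
    have : (1 : ℝ) ≤ n := by exact_mod_cast hn
    linarith
  have h2 : (n : ℝ) ^ K * s ^ n ≤ C * r ^ n := by
    have := hC' n
    rwa [div_pow, ← mul_div_assoc, div_le_iff₀ (by positivity)] at this
  calc s ^ n * ((n : ℝ) + 1) ^ K ≤ s ^ n * (2 ^ K * (n : ℝ) ^ K) := by gcongr
    _ = 2 ^ K * ((n : ℝ) ^ K * s ^ n) := by ring
    _ ≤ 2 ^ K * (C * r ^ n) := by gcongr
    _ = 2 ^ K * C * r ^ n := by ring
    _ ≤ _ := by gcongr; exact le_max_left _ _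

/-- Under a Diophantine condition on `Q` the `q`-exponential coefficients decay
exponentially. -/
theorem exists_norm_qexpCoeff_le {Q : ℂ} {τ c : ℝ} (hc : 0 < c)
    (hQ : ∀ m : ℕ, 1 ≤ m → c ≤ (m : ℝ) ^ τ * ‖1 - Q ^ m‖) {κ : ℂ} (hκ : ‖κ‖ < 1) :
    ∃ r C : ℝ, 0 < r ∧ r < 1 ∧ 0 < C ∧ ∀ n : ℕ, ‖qexpCoeff Q κ n‖ ≤ C * r ^ n := by
  have hQ1 : ∀ m : ℕ, 1 ≤ m → Q ^ m ≠ 1 := by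
    intro m hm h
    have := hQ m hm
    simp [h] at this
    linarith
  obtain ⟨s, hs1, hs2⟩ := exists_between hκ
  obtain ⟨r, hr1, hr2⟩ := exists_between hs2
  have hs0 : 0 < s := (norm_nonneg _).trans_lt hs1
  obtain ⟨T, hT⟩ := exists_nat_ge τ
  obtain ⟨D, hD0, hD⟩ := exists_succ_pow_mul_pow_le T (norm_nonneg κ) hs1
  obtain ⟨K, hK⟩ := exists_nat_ge (D / c)
  obtain ⟨C, hC0, hC⟩ := exists_succ_pow_mul_pow_le K hs0.le hr1
  refine ⟨r, C, hs0.trans hr1, hr2, hC0, fun n => ?_⟩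
  refine (norm_qexpCoeff_le hQ1 hs0.le (K := K) (fun m hm => ?_) n).trans (hC n)
  have hm1 : (1 : ℝ) ≤ m := by exact_mod_cast hm
  have hpos : 0 < ‖1 - Q ^ m‖ := norm_pos_iff.2 (sub_ne_zero.2 (hQ1 m hm).symm)
  have hmT : (m : ℝ) ^ τ ≤ ((m : ℝ) + 1) ^ T := by
    calc (m : ℝ) ^ τ ≤ (m : ℝ) ^ (T : ℝ) := Real.rpow_le_rpow_of_exponent_le hm1 hT
      _ = (m : ℝ) ^ T := Real.rpow_natCast _ _
      _ ≤ _ := by gcongr; linarith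
  rw [norm_div, norm_pow, div_le_iff₀ hpos]
  have h1 : c ≤ ((m : ℝ) + 1) ^ T * ‖1 - Q ^ m‖ := (hQ m hm).trans (by gcongr)
  have h2 := hD m
  have h3 : D ≤ K * c := by rwa [div_le_iff₀ hc] at hK
  have h4 : ‖κ‖ ^ m * c ≤ K * c * s ^ m * ‖1 - Q ^ m‖ := by
    calc ‖κ‖ ^ m * c ≤ ‖κ‖ ^ m * (((m : ℝ) + 1) ^ T * ‖1 - Q ^ m‖) := by gcongr
      _ = ‖κ‖ ^ m * ((m : ℝ) + 1) ^ T * ‖1 - Q ^ m‖ := by ring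
      _ ≤ D * s ^ m * ‖1 - Q ^ m‖ := by gcongr
      _ ≤ _ := by gcongr
  nlinarith


/-- The coefficients of the `q`-exponential series, extended by zero to the negative integers. -/
def qexpInt (Q κ : ℂ) (n : ℤ) : ℂ := if 0 ≤ n then qexpCoeff Q κ n.toNat else 0

/-- The coefficients of the reciprocal of the `q`-exponential series. -/
def qexpInvCoeff (Q κ : ℂ) (n : ℕ) : ℂ := ∏ j ∈ Finset.range n, -κ * Q ^ j / (1 - Q ^ (j + 1))

/-- The coefficients of the reciprocal of the `q`-exponential series, extended by zero to the
negative integers. -/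
def qexpInvInt (Q κ : ℂ) (n : ℤ) : ℂ := if 0 ≤ n then qexpInvCoeff Q κ n.toNat else 0

theorem zpow_mul_qexpInt {Q : ℂ} (hQ : ∀ m : ℕ, 1 ≤ m → Q ^ m ≠ 1) (κ : ℂ) (n : ℤ) :
    Q ^ n * qexpInt Q κ n = qexpInt Q κ n - κ * qexpInt Q κ (n - 1) := by
  rcases lt_trichotomy n 0 with h | rfl | h
  · simp [qexpInt, not_le.2 h, show ¬ (1 ≤ n) by omega]
  · simp [qexpInt]
  · obtain ⟨m, rfl⟩ : ∃ m : ℕ, n = (m : ℤ) + 1 := ⟨(n - 1).toNat, by omega⟩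
    have h1 : ((m : ℤ) + 1).toNat = m + 1 := by omega
    simp only [qexpInt, add_sub_cancel_right, Int.natCast_nonneg, Int.toNat_natCast, if_true, h1,
      show (0 : ℤ) ≤ m + 1 by omega]
    rw [← qexpCoeff_succ_mul hQ, ← Nat.cast_succ, zpow_natCast, Nat.succ_eq_add_one]
    ring

theorem qexpInvInt_eq {Q : ℂ} (hQ : ∀ m : ℕ, 1 ≤ m → Q ^ m ≠ 1) (κ : ℂ) (n : ℤ) :
    qexpInvInt Q κ n = Q ^ n * qexpInvInt Q κ n - κ * Q ^ (n - 1) * qexpInvInt Q κ (n - 1) := by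
  rcases lt_trichotomy n 0 with h | rfl | h
  · simp [qexpInvInt, not_le.2 h, show ¬ (1 ≤ n) by omega]
  · simp [qexpInvInt]
  · obtain ⟨m, rfl⟩ : ∃ m : ℕ, n = (m : ℤ) + 1 := ⟨(n - 1).toNat, by omega⟩
    have h1 : ((m : ℤ) + 1).toNat = m + 1 := by omega
    have h0 : 1 - Q ^ (m + 1) ≠ 0 := sub_ne_zero.2 (hQ (m + 1) (by omega)).symm
    simp only [qexpInvInt, add_sub_cancel_right, Int.natCast_nonneg, Int.toNat_natCast, if_true,
      h1, show (0 : ℤ) ≤ m + 1 by omega]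
    have h2 : qexpInvCoeff Q κ (m + 1) * (1 - Q ^ (m + 1)) = -κ * Q ^ m * qexpInvCoeff Q κ m := by
      rw [qexpInvCoeff, Finset.prod_range_succ, ← qexpInvCoeff]
      field_simp
    rw [← Nat.cast_succ, zpow_natCast, zpow_natCast, Nat.succ_eq_add_one]
    linear_combination h2

theorem norm_qexpInvInt {Q : ℂ} (hQ1 : ‖Q‖ = 1) (κ : ℂ) (n : ℤ) :
    ‖qexpInvInt Q κ n‖ = ‖qexpInt Q κ n‖ := by
  unfold qexpInvInt qexpInt
  split_ifs
  · simp [qexpInvCoeff, qexpCoeff, norm_prod, hQ1]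
  · rfl

theorem summable_pow_natAbs {t : ℝ} (h0 : 0 ≤ t) (h1 : t < 1) :
    Summable fun n : ℤ => t ^ n.natAbs :=
  Summable.of_nat_of_neg (by simpa using summable_geometric_of_lt_one h0 h1)
    (by simpa using summable_geometric_of_lt_one h0 h1)

theorem summable_norm_of_le_pow_natAbs {f : ℤ → ℂ} {C t : ℝ} (h0 : 0 ≤ t) (h1 : t < 1)
    (hf : ∀ n, ‖f n‖ ≤ C * t ^ n.natAbs) : Summable fun n => ‖f n‖ :=
  Summable.of_nonneg_of_le (fun _ => norm_nonneg _) hf ((summable_pow_natAbs h0 h1).mul_left C)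

/-- The correlation of two sequences on `ℤ`. -/
def correlation (f g : ℤ → ℂ) (n : ℤ) : ℂ := ∑' j : ℤ, f (n + j) * g j

theorem summable_correlation {f g : ℤ → ℂ} (hf : Summable fun n => ‖f n‖)
    (hg : Summable fun n => ‖g n‖) (n : ℤ) : Summable fun j : ℤ => f (n + j) * g j := by
  have h := summable_mul_of_summable_norm hf hg
  exact h.comp_injective (i := fun j : ℤ => (n + j, j)) fun a b hab => (Prod.ext_iff.1 hab).2

theorem hasSum_correlation {f g : ℤ → ℂ} (hf : Summable fun n => ‖f n‖)
    (hg : Summable fun n => ‖g n‖) :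
    HasSum (correlation f g) ((∑' n, f n) * ∑' n, g n) := by
  have h := (hf.of_norm.hasSum.mul hg.of_norm.hasSum (summable_mul_of_summable_norm hf hg))
  let σ : ℤ × ℤ ≃ ℤ × ℤ :=
    { toFun := fun p => (p.1 + p.2, p.2)
      invFun := fun p => (p.1 - p.2, p.2)
      left_inv := fun p => by simp
      right_inv := fun p => by simp }
  have h2 := σ.hasSum_iff.2 h
  exact h2.prod_fiberwise fun n => (summable_correlation hf hg n).hasSum

theorem norm_correlation_le {f g : ℤ → ℂ} {C t : ℝ} (h0 : 0 < t) (h1 : t < 1)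
    (hf : ∀ n, ‖f n‖ ≤ C * (t ^ 2) ^ n.natAbs) (hg : ∀ n, ‖g n‖ ≤ C * (t ^ 2) ^ n.natAbs)
    (n : ℤ) : ‖correlation f g n‖ ≤ C ^ 2 * (∑' j : ℤ, t ^ j.natAbs) * t ^ n.natAbs := by
  have hC : 0 ≤ C := by simpa using (norm_nonneg _).trans (hf 0)
  have hb : ∀ j : ℤ, ‖f (n + j) * g j‖ ≤ C ^ 2 * t ^ n.natAbs * t ^ j.natAbs := by
    intro j
    rw [norm_mul]
    calc ‖f (n + j)‖ * ‖g j‖ ≤ (C * (t ^ 2) ^ (n + j).natAbs) * (C * (t ^ 2) ^ j.natAbs) := by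
          gcongr
          · exact hf _
          · exact hg _
      _ = C ^ 2 * t ^ (2 * (n + j).natAbs + 2 * j.natAbs) := by
        rw [pow_add, pow_mul, pow_mul]; ring
      _ ≤ C ^ 2 * t ^ (n.natAbs + j.natAbs) := by
        refine mul_le_mul_of_nonneg_left ?_ (by positivity)
        exact pow_le_pow_of_le_one h0.le h1.le (by omega)
      _ = _ := by rw [pow_add]; ring
  have hs := (summable_pow_natAbs h0.le h1).mul_left (C ^ 2 * t ^ n.natAbs)
  refine (tsum_of_norm_bounded hs.hasSum hb).trans (le_of_eq ?_)
  rw [tsum_mul_left]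
  ring

theorem correlation_shift_right (f g : ℤ → ℂ) (n : ℤ) :
    ∑' j : ℤ, f (n + j) * g (j - 1) = correlation f g (n + 1) := by
  rw [correlation, ← (Equiv.addRight (1 : ℤ)).tsum_eq]
  refine tsum_congr fun j => ?_
  simp [add_assoc, add_comm j 1]

theorem correlation_shift_left (f g : ℤ → ℂ) (n : ℤ) :
    ∑' j : ℤ, f (n + j - 1) * g j = correlation f g (n - 1) :=
  tsum_congr fun j => by rw [show n + j - 1 = n - 1 + j by ring]

theorem summable_norm_shift {f : ℤ → ℂ} (hf : Summable fun n => ‖f n‖) (k : ℤ) :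
    Summable fun n => ‖f (n + k)‖ :=
  hf.comp_injective (add_left_injective k)

/-- The autocorrelation of a solution of `f (Q ζ) = (1 - κ ζ) f ζ` solves a three-term
recurrence. -/
theorem zpow_mul_correlation_self {Q : ℂ} (hQ0 : Q ≠ 0) {κ : ℂ} {f : ℤ → ℂ}
    (hf : Summable fun n => ‖f n‖) (hrel : ∀ n, Q ^ n * f n = f n - κ * f (n - 1)) (n : ℤ) :
    Q ^ n * (correlation f f n - κ * correlation f f (n + 1))
      = correlation f f n - κ * correlation f f (n - 1) := by
  have hf1 : Summable fun n => ‖f (n - 1)‖ := summable_norm_shift hf (-1)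
  have s0 : Summable fun j : ℤ => f (n + j) * f j := summable_correlation hf hf n
  have s1 : Summable fun j : ℤ => f (n + j) * f (j - 1) := summable_correlation hf hf1 n
  have s2 : Summable fun j : ℤ => f (n + j - 1) * f j := summable_correlation hf1 hf n
  have e1 : correlation f f n - κ * correlation f f (n + 1)
      = ∑' j : ℤ, f (n + j) * (f j - κ * f (j - 1)) := by
    rw [← correlation_shift_right, correlation, ← tsum_mul_left, ← s0.tsum_sub (s1.mul_left κ)]
    exact tsum_congr fun j => by ring
  have e2 : correlation f f n - κ * correlation f f (n - 1)
      = ∑' j : ℤ, (f (n + j) - κ * f (n + j - 1)) * f j := by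
    rw [← correlation_shift_left, correlation, ← tsum_mul_left, ← s0.tsum_sub (s2.mul_left κ)]
    exact tsum_congr fun j => by ring
  rw [e1, e2, ← tsum_mul_left]
  refine tsum_congr fun j => ?_
  rw [← hrel, ← hrel, zpow_add₀ hQ0]
  ring

/-- Convolving a solution of `f (Q ζ) = (1 - κ ζ) f ζ` with a solution of
`g ζ = (1 - κ ζ) g (Q ζ)` gives a sequence invariant under multiplication by `Q ^ n`. -/
theorem zpow_mul_correlation_reflect {Q : ℂ} (hQ0 : Q ≠ 0) {κ : ℂ} {f g : ℤ → ℂ}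
    (hf : Summable fun n => ‖f n‖) (hg : Summable fun n => ‖Q ^ n * g n‖)
    (hrel : ∀ n, Q ^ n * f n = f n - κ * f (n - 1))
    (hrel' : ∀ n, g n = Q ^ n * g n - κ * (Q ^ (n - 1) * g (n - 1))) (n : ℤ) :
    Q ^ n * correlation f (fun j => g (-j)) n = correlation f (fun j => g (-j)) n := by
  have hg0 : Summable fun j => ‖Q ^ (-j) * g (-j)‖ := hg.comp_injective neg_injective
  have hg1 : Summable fun j => ‖Q ^ (-(j + 1)) * g (-(j + 1))‖ := summable_norm_shift hg0 1
  have hf1 : Summable fun n => ‖f (n - 1)‖ := summable_norm_shift hf (-1)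
  have s0 : Summable fun j : ℤ => f (n + j) * (Q ^ (-j) * g (-j)) :=
    summable_correlation hf hg0 n
  have s1 : Summable fun j : ℤ => f (n + j) * (Q ^ (-(j + 1)) * g (-(j + 1))) :=
    summable_correlation hf hg1 n
  have s2 : Summable fun j : ℤ => f (n + j - 1) * (Q ^ (-j) * g (-j)) :=
    summable_correlation hf1 hg0 n
  have sh : ∑' j : ℤ, f (n + j - 1) * (Q ^ (-j) * g (-j))
      = ∑' j : ℤ, f (n + j) * (Q ^ (-(j + 1)) * g (-(j + 1))) := by
    rw [← (Equiv.addRight (1 : ℤ)).tsum_eq]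
    exact tsum_congr fun j => by simp [← add_assoc]
  calc Q ^ n * correlation f (fun j => g (-j)) n
      = ∑' j : ℤ, (f (n + j) * (Q ^ (-j) * g (-j))
          - κ * (f (n + j - 1) * (Q ^ (-j) * g (-j)))) := by
        rw [correlation, ← tsum_mul_left]
        refine tsum_congr fun j => ?_
        have := hrel (n + j)
        rw [← mul_assoc κ, ← sub_mul, ← this, zpow_add₀ hQ0, zpow_neg]
        field_simp
    _ = ∑' j : ℤ, (f (n + j) * (Q ^ (-j) * g (-j))
          - κ * (f (n + j) * (Q ^ (-(j + 1)) * g (-(j + 1))))) := by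
        rw [s0.tsum_sub (s2.mul_left κ), s0.tsum_sub (s1.mul_left κ), tsum_mul_left,
          tsum_mul_left, sh]
    _ = correlation f (fun j => g (-j)) n := by
        refine tsum_congr fun j => ?_
        have := hrel' (-j)
        rw [show -(j + 1) = -j - 1 by ring]
        linear_combination -f (n + j) * this

theorem tsum_qexpInt_ne_zero {Q : ℂ} (hQ1 : ‖Q‖ = 1)
    (hQ : ∀ m : ℕ, 1 ≤ m → Q ^ m ≠ 1) {κ : ℂ} (hs : Summable fun n => ‖qexpInt Q κ n‖) :
    ∑' n, qexpInt Q κ n ≠ 0 := by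
  have hQ0 : Q ≠ 0 := norm_ne_zero_iff.1 (by rw [hQ1]; exact one_ne_zero)
  have hg : Summable fun n => ‖qexpInvInt Q κ n‖ := by simpa only [norm_qexpInvInt hQ1] using hs
  have hb : Summable fun n => ‖qexpInvInt Q κ (-n)‖ := hg.comp_injective neg_injective
  have hg' : Summable fun n => ‖Q ^ n * qexpInvInt Q κ n‖ := by simpa [hQ1] using hg
  have inv := zpow_mul_correlation_reflect hQ0 hs hg' (zpow_mul_qexpInt hQ κ)
    (fun n => by rw [← mul_assoc]; exact qexpInvInt_eq hQ κ n)
  have hne : ∀ n : ℤ, n ≠ 0 → Q ^ n ≠ 1 := by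
    intro n hn h
    obtain ⟨m, rfl | rfl⟩ := n.eq_nat_or_neg
    · exact hQ m (by omega) (by simpa using h)
    · exact hQ m (by omega) (by simpa using h)
  have h0 : correlation (qexpInt Q κ) (fun j => qexpInvInt Q κ (-j)) 0 = 1 := by
    rw [correlation, tsum_eq_single 0]
    · simp [qexpInt, qexpInvInt, qexpCoeff, qexpInvCoeff]
    · intro j hj
      rcases lt_or_gt_of_ne hj with h | h
      · simp [qexpInt, not_le.2 h]
      · simp [qexpInvInt, not_le.2 h]
  have hprod := (hasSum_correlation hs hb).unique (hasSum_single (0 : ℤ) fun n hn => by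
    have h := inv n
    exact (mul_eq_zero.1 (show (Q ^ n - 1) *
      correlation (qexpInt Q κ) (fun j => qexpInvInt Q κ (-j)) n = 0 by
      rw [sub_mul, h, one_mul, sub_self])).resolve_left (sub_ne_zero.2 (hne n hn)))
  rw [h0] at hprod
  exact left_ne_zero_of_mul (hprod ▸ one_ne_zero)

/-- Existence of an exponentially localized solution of the eigenvalue recurrence. -/
theorem exists_localized_solution {Q : ℂ} (hQ1 : ‖Q‖ = 1) {τ c : ℝ} (hc : 0 < c)
    (hQ : ∀ m : ℕ, 1 ≤ m → c ≤ (m : ℝ) ^ τ * ‖1 - Q ^ m‖) {κ : ℂ} (hκ : ‖κ‖ < 1) :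
    ∃ (v : ℤ → ℂ) (C t : ℝ), 0 < t ∧ t < 1 ∧ (∀ n, ‖v n‖ ≤ C * t ^ n.natAbs) ∧
      (∀ n, Q ^ n * (v n - κ * v (n + 1)) = v n - κ * v (n - 1)) ∧ ∃ n, v n ≠ 0 := by
  have hQne : ∀ m : ℕ, 1 ≤ m → Q ^ m ≠ 1 := by
    intro m hm h
    have := hQ m hm
    simp [h] at this
    linarith
  have hQ0 : Q ≠ 0 := norm_ne_zero_iff.1 (by rw [hQ1]; exact one_ne_zero)
  obtain ⟨r, C, hr0, hr1, hC0, hC⟩ := exists_norm_qexpCoeff_le hc hQ hκ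
  have hdecay : ∀ n, ‖qexpInt Q κ n‖ ≤ C * r ^ n.natAbs := by
    intro n
    unfold qexpInt
    split_ifs with h
    · rw [show n.natAbs = n.toNat by omega]; exact hC _
    · simpa using by positivity
  have hs := summable_norm_of_le_pow_natAbs hr0.le hr1 hdecay
  have ht0 : 0 < √r := Real.sqrt_pos.2 hr0
  have ht1 : √r < 1 := by rwa [Real.sqrt_lt' one_pos, one_pow]
  have hdecay' : ∀ n, ‖qexpInt Q κ n‖ ≤ C * (√r ^ 2) ^ n.natAbs := by
    rwa [Real.sq_sqrt hr0.le]
  refine ⟨correlation (qexpInt Q κ) (qexpInt Q κ), _, √r, ht0, ht1,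
    norm_correlation_le ht0 ht1 hdecay' hdecay',
    zpow_mul_correlation_self hQ0 hs (zpow_mul_qexpInt hQne κ), ?_⟩
  by_contra! h
  have h1 := hasSum_correlation hs hs
  rw [show correlation (qexpInt Q κ) (qexpInt Q κ) = fun _ => 0 from funext h] at h1
  have h2 := tsum_qexpInt_ne_zero hQ1 hQne hs
  exact mul_ne_zero h2 h2 (h1.unique hasSum_zero)

/-- Entries of the doubly infinite block diagonal matrix whose block `Θ n` acts on `{n, n + 1}`
for every `n` satisfying `p`. -/
def blockEntry (p : ℤ → Prop) [DecidablePred p] (α : ℤ → ℂ) (i j : ℤ) : ℂ :=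
  if p i ∧ j = i then conj (α i)
  else if p i ∧ j = i + 1 then rho α i
  else if p j ∧ i = j + 1 then rho α j
  else if ¬ p i ∧ j = i then -α (i - 1)
  else 0

/-- The block diagonal matrix with entries `blockEntry`, acting on sequences. -/
def blockMul (p : ℤ → Prop) [DecidablePred p] (α f : ℤ → ℂ) (i : ℤ) : ℂ :=
  if p i then conj (α i) * f i + rho α i * f (i + 1)
  else rho α (i - 1) * f (i - 1) - α (i - 1) * f i

/-- The principal submatrix of the block diagonal matrix on `{a, …, b}`. -/
def blockMatrix (p : ℤ → Prop) [DecidablePred p] (α : ℤ → ℂ) (a b : ℤ) :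
    Matrix (Set.Icc a b) (Set.Icc a b) ℂ :=
  fun i j => blockEntry p α i j

theorem subL_eq_blockMatrix (α : ℤ → ℂ) (a b : ℤ) : subL α a b = blockMatrix Even α a b := by
  ext i j
  simp only [subL, blockMatrix, cmvL, blockEntry, Int.not_even_iff_odd]

theorem subM_eq_blockMatrix (α : ℤ → ℂ) (a b : ℤ) : subM α a b = blockMatrix Odd α a b := by
  ext i j
  simp only [subM, blockMatrix, cmvM, blockEntry, Int.not_odd_iff_even]

section Block

variable {p : ℤ → Prop} [DecidablePred p]

theorem blockEntry_of_pos (hp : ∀ n, p (n + 1) ↔ ¬ p n) (α : ℤ → ℂ) {i : ℤ} (hi : p i) (j : ℤ) :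
    blockEntry p α i j
      = (if j = i then conj (α i) else 0) + (if j = i + 1 then rho α i else 0) := by
  have h := hp j
  unfold blockEntry
  by_cases h1 : j = i
  · subst h1; simp [hi]
  · by_cases h2 : j = i + 1
    · subst h2; simp [hi]
    · have h3 : ¬ (p j ∧ i = j + 1) := by
        rintro ⟨h3, h4⟩
        rw [← h4] at h
        exact h.1 hi h3
      simp [h1, h2, h3]

theorem blockEntry_of_neg (hp : ∀ n, p (n + 1) ↔ ¬ p n) (α : ℤ → ℂ) {i : ℤ} (hi : ¬ p i) (j : ℤ) :
    blockEntry p α i j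
      = (if j = i - 1 then rho α (i - 1) else 0) + (if j = i then -α (i - 1) else 0) := by
  have h := hp (i - 1)
  rw [sub_add_cancel] at h
  have h' : p (i - 1) := by tauto
  unfold blockEntry
  by_cases h1 : j = i
  · subst h1; simp [hi, show j ≠ j - 1 by omega]
  · by_cases h2 : j = i - 1
    · subst h2; simp [hi, h']
    · have h3 : ¬ (i = j + 1) := by omega
      simp [h1, h2, h3, hi]

theorem blockMatrix_mulVec (hp : ∀ n, p (n + 1) ↔ ¬ p n) {α : ℤ → ℂ} {a b : ℤ}
    (ha : rho α (a - 1) = 0) (hb : rho α b = 0) (f : ℤ → ℂ) :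
    (blockMatrix p α a b *ᵥ fun j => f j) = fun i : Set.Icc a b => blockMul p α f i := by
  ext ⟨i, hi1, hi2⟩
  have e : (blockMatrix p α a b *ᵥ fun j => f j) ⟨i, hi1, hi2⟩
      = ∑ j ∈ Finset.Icc a b, blockEntry p α i j * f j := by
    rw [Matrix.mulVec, dotProduct, ← Set.toFinset_Icc,
      ← Finset.sum_set_coe (f := fun j => blockEntry p α i j * f j)]
    rfl
  rw [e]
  by_cases h : p i
  · simp only [blockMul, if_pos h, blockEntry_of_pos hp α h, add_mul, ite_mul, zero_mul,
      Finset.sum_add_distrib, Finset.sum_ite_eq', Finset.mem_Icc, hi1, hi2, and_self, if_true]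
    split_ifs with h2
    · rfl
    · rw [show i = b by omega, hb, zero_mul]
  · simp only [blockMul, if_neg h, blockEntry_of_neg hp α h, add_mul, ite_mul, zero_mul,
      Finset.sum_add_distrib, Finset.sum_ite_eq', Finset.mem_Icc, hi1, hi2, and_self, if_true]
    split_ifs with h2
    · ring
    · rw [show i = a by omega, ha]; ring

theorem rho_conj (α : ℤ → ℂ) (n : ℤ) : rho (fun n => conj (α n)) n = rho α n := by simp [rho]

theorem rho_mul_self {α : ℤ → ℂ} {n : ℤ} (h : ‖α n‖ ≤ 1) :
    rho α n * rho α n = 1 - conj (α n) * α n := by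
  have h0 : 0 ≤ 1 - ‖α n‖ ^ 2 := by nlinarith [norm_nonneg (α n)]
  rw [rho, ← Complex.ofReal_mul, Real.mul_self_sqrt h0, mul_comm, Complex.mul_conj,
    Complex.normSq_eq_norm_sq]
  push_cast
  rfl

theorem blockMul_conj_blockMul (hp : ∀ n, p (n + 1) ↔ ¬ p n) {α : ℤ → ℂ} (hα : ∀ n, ‖α n‖ ≤ 1)
    (f : ℤ → ℂ) (i : ℤ) :
    blockMul p (fun n => conj (α n)) (blockMul p α f) i = f i := by
  by_cases h : p i
  · have h1 : ¬ p (i + 1) := fun h1 => (hp i).1 h1 h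
    simp only [blockMul, if_pos h, if_neg h1, rho_conj, add_sub_cancel_right, Complex.conj_conj]
    linear_combination f i * rho_mul_self (hα i)
  · have h1 : p (i - 1) := by
      have := hp (i - 1)
      rw [sub_add_cancel] at this
      tauto
    simp only [blockMul, if_pos h1, if_neg h, rho_conj, sub_add_cancel]
    linear_combination f i * rho_mul_self (hα (i - 1))

theorem blockMatrix_conjTranspose (hp : ∀ n, p (n + 1) ↔ ¬ p n) (α : ℤ → ℂ) (a b : ℤ) :
    (blockMatrix p α a b)ᴴ = blockMatrix p (fun n => conj (α n)) a b := by
  ext ⟨i, hi⟩ ⟨j, hj⟩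
  have hr : ∀ n, conj (rho α n) = rho α n := fun n => by simp [rho]
  have hpi := hp (i - 1)
  have hpj := hp (j - 1)
  rw [sub_add_cancel] at hpi hpj
  simp only [Matrix.conjTranspose_apply, blockMatrix]
  by_cases h : p i <;> by_cases h' : p j
  · rw [blockEntry_of_pos hp _ h, blockEntry_of_pos hp _ h']
    have h1 : i ≠ j + 1 := by rintro rfl; exact (hp j).1 h h'
    have h2 : j ≠ i + 1 := by rintro rfl; exact (hp i).1 h' h
    by_cases h3 : i = j
    · subst h3; simp
    · simp [h1, h2, h3, Ne.symm h3]
  · rw [blockEntry_of_pos hp _ h, blockEntry_of_neg hp _ h']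
    have h1 : i ≠ j := by rintro rfl; exact h' h
    by_cases h3 : j = i + 1
    · subst h3; simp [hr, rho_conj]
    · simp [h1, h1.symm, h3, show i ≠ j - 1 by omega]
  · rw [blockEntry_of_neg hp _ h, blockEntry_of_pos hp _ h']
    have h1 : i ≠ j := by rintro rfl; exact h h'
    by_cases h3 : i = j + 1
    · subst h3; simp [hr, rho_conj]
    · simp [h1, h1.symm, h3, show j ≠ i - 1 by omega]
  · rw [blockEntry_of_neg hp _ h, blockEntry_of_neg hp _ h']
    have h1 : i ≠ j - 1 := by rintro rfl; tauto
    have h2 : j ≠ i - 1 := by rintro rfl; tauto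
    by_cases h3 : i = j
    · subst h3; simp [h1]
    · simp [h1, h2, h3, Ne.symm h3]

theorem blockMatrix_mem_unitaryGroup (hp : ∀ n, p (n + 1) ↔ ¬ p n) {α : ℤ → ℂ}
    (hα : ∀ n, ‖α n‖ ≤ 1) {a b : ℤ} (ha : rho α (a - 1) = 0) (hb : rho α b = 0) :
    blockMatrix p α a b ∈ Matrix.unitaryGroup (Set.Icc a b) ℂ := by
  rw [Matrix.mem_unitaryGroup_iff', Matrix.star_eq_conjTranspose, blockMatrix_conjTranspose hp]
  refine Matrix.ext_of_mulVec_single fun k => ?_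
  obtain ⟨f, hf⟩ : ∃ f : ℤ → ℂ, (Pi.single k 1 : Set.Icc a b → ℂ)
      = fun j : Set.Icc a b => f (j : ℤ) :=
    ⟨fun n => if n = (k : ℤ) then 1 else 0, by
      ext j
      simp [Pi.single_apply, Subtype.ext_iff]⟩
  rw [hf, ← Matrix.mulVec_mulVec, blockMatrix_mulVec hp ha hb,
    blockMatrix_mulVec hp (by rwa [rho_conj]) (by rwa [rho_conj]), Matrix.one_mulVec]
  ext i
  exact blockMul_conj_blockMul hp hα _ _

end Block

open scoped Matrix.Norms.L2Operator in
/-- An approximate eigenvector of a unitary matrix yields a nearby eigenvalue. -/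
theorem exists_isRoot_charpoly_near {ι : Type*} [Fintype ι] [DecidableEq ι] {U : Matrix ι ι ℂ}
    (hU : U ∈ Matrix.unitaryGroup ι ℂ) {w : ι → ℂ} (hw : w ≠ 0) {z : ℂ} {ε : ℝ}
    (h : ‖WithLp.toLp 2 (U *ᵥ w - z • w)‖ ≤ ε * ‖WithLp.toLp 2 w‖) :
    ∃ μ, U.charpoly.IsRoot μ ∧ ‖μ - z‖ ≤ ε := by
  have hwpos : 0 < ‖WithLp.toLp 2 w‖ := by
    rw [norm_pos_iff]
    simpa using hw
  have hε : 0 ≤ ε := by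
    by_contra! hneg
    have := (norm_nonneg _).trans h
    nlinarith
  have hmem : ∀ μ, μ ∈ spectrum ℂ U → U.charpoly.IsRoot μ := fun μ hμ =>
    Matrix.mem_spectrum_iff_isRoot_charpoly.1 hμ
  by_cases hz : z ∈ spectrum ℂ U
  · exact ⟨z, hmem z hz, by simpa using hε⟩
  have hunit : IsUnit (U - algebraMap ℂ _ z) := by
    rw [spectrum.notMem_iff] at hz
    simpa using hz.neg
  obtain ⟨A, hA⟩ := hunit
  have : Nontrivial (Matrix ι ι ℂ) := by
    obtain ⟨i, -⟩ := Function.ne_iff.1 hw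
    have : Nonempty ι := ⟨i⟩
    infer_instance
  have hUU : U * star U = star U * U := by
    rw [Matrix.mem_unitaryGroup_iff.1 hU, Matrix.mem_unitaryGroup_iff'.1 hU]
  have hAn : IsStarNormal (A : Matrix ι ι ℂ) := by
    rw [isStarNormal_iff, hA]
    have : Commute U (star U) := hUU
    rw [star_sub, ← algebraMap_star_comm]
    refine Commute.sub_left (Commute.sub_right this.symm ?_) ?_
    · exact (Algebra.commutes _ _).symm
    · exact Algebra.commutes _ _
  have hBn : IsStarNormal ((A⁻¹ : (Matrix ι ι ℂ)ˣ) : Matrix ι ι ℂ) :=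
    inferInstance
  obtain ⟨k, hk, hkn⟩ := spectrum.exists_nnnorm_eq_spectralRadius
    ((A⁻¹ : (Matrix ι ι ℂ)ˣ) : Matrix ι ι ℂ)
  rw [hBn.spectralRadius_eq_nnnorm] at hkn
  have hkn' : ‖k‖ = ‖((A⁻¹ : (Matrix ι ι ℂ)ˣ) : Matrix ι ι ℂ)‖ := by
    have := ENNReal.coe_injective hkn
    exact congrArg NNReal.toReal this
  have hk0 : k ≠ 0 := by
    rintro rfl
    exact spectrum.zero_notMem ℂ (A⁻¹).isUnit hk
  have hkinv : k⁻¹ ∈ spectrum ℂ (A : Matrix ι ι ℂ) := by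
    have := spectrum.inv_mem_iff (r := (Units.mk0 k hk0)⁻¹) (a := A)
    simpa using this.2 (by simpa using hk)
  refine ⟨k⁻¹ + z, hmem _ ?_, ?_⟩
  · rw [spectrum.add_mem_iff, neg_add_eq_sub, ← hA]
    exact hkinv
  · rw [add_sub_cancel_right, norm_inv, hkn']
    have hBpos : 0 < ‖((A⁻¹ : (Matrix ι ι ℂ)ˣ) : Matrix ι ι ℂ)‖ := hkn' ▸ norm_pos_iff.2 hk0
    rw [inv_le_iff_one_le_mul₀ hBpos]
    have hAw : U *ᵥ w - z • w = (A : Matrix ι ι ℂ) *ᵥ w := by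
      rw [hA, Matrix.sub_mulVec, Algebra.algebraMap_eq_smul_one, Matrix.smul_mulVec,
        Matrix.one_mulVec]
    have hle := Matrix.l2_opNorm_mulVec ((A⁻¹ : (Matrix ι ι ℂ)ˣ) : Matrix ι ι ℂ)
      (WithLp.toLp 2 (U *ᵥ w - z • w))
    have hback : ((A⁻¹ : (Matrix ι ι ℂ)ˣ) : Matrix ι ι ℂ) *ᵥ (U *ᵥ w - z • w) = w := by
      rw [hAw, Matrix.mulVec_mulVec, Units.inv_mul, Matrix.one_mulVec]
    simp only [hback] at hle
    have hle' : ‖WithLp.toLp 2 w‖ ≤ _ := hle.trans (mul_le_mul_of_nonneg_left h hBpos.le)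
    refine le_of_mul_le_mul_right ?_ hwpos
    linarith

/-- The even-odd splitting of a solution of the transfer matrix recursion into a generalized
eigenvector of the extended CMV matrix `𝓛𝓜`. -/
theorem exists_blockMul_of_transfer {α : ℤ → ℂ} {r z : ℂ} (hr : r ≠ 0) (hz : z ≠ 0)
    (hρ : ∀ n, rho α n = r) (hα : ∀ n, ‖α n‖ ≤ 1) {u v : ℤ → ℂ}
    (hu : ∀ n, r * u (n + 1) = z * (u n - conj (α n) * v n))
    (hv : ∀ n, r * v (n + 1) = v n - α n * u n) :
    ∃ ψ χ : ℤ → ℂ, (∀ n, blockMul Odd α ψ n = χ n) ∧ (∀ n, blockMul Even α χ n = z * ψ n) ∧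
      ∀ n, ∃ k l : ℤ, (ψ n = z ^ k * u n ∧ χ n = z ^ l * v n) ∨
        (ψ n = z ^ k * v n ∧ χ n = z ^ l * u n) := by
  have hr2 : ∀ n, r * r = 1 - conj (α n) * α n := fun n => by
    rw [← hρ n]; exact rho_mul_self (hα n)
  let ψ : ℤ → ℂ := fun n => z ^ (-(n / 2) - 1) * if Even n then u n else v n
  let χ : ℤ → ℂ := fun n => if Even n then z ^ (-(n / 2)) * v n else z ^ (-(n / 2) - 1) * u n
  have ψe : ∀ j : ℤ, ψ (2 * j) = z ^ (-j - 1) * u (2 * j) := fun j => by simp [ψ]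
  have χe : ∀ j : ℤ, χ (2 * j) = z ^ (-j - 1) * z * v (2 * j) := fun j => by
    rw [← zpow_add_one₀ hz]; simp [χ]
  have hd : ∀ j : ℤ, (2 * j + 1) / 2 = j := fun j => by omega
  have ψo : ∀ j : ℤ, ψ (2 * j + 1) = z ^ (-j - 1) * v (2 * j + 1) := fun j => by
    simp [ψ, hd]
  have χo : ∀ j : ℤ, χ (2 * j + 1) = z ^ (-j - 1) * u (2 * j + 1) := fun j => by
    simp [χ, hd]
  have ψs : ∀ j : ℤ, ψ (2 * j + 1 + 1) * z = z ^ (-j - 1) * u (2 * j + 1 + 1) := fun j => by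
    rw [show 2 * j + 1 + 1 = 2 * (j + 1) by ring, ψe, show -j - 1 = -(j + 1) - 1 + 1 by ring,
      zpow_add_one₀ hz]
    ring_nf
  have χs : ∀ j : ℤ, χ (2 * j + 1 + 1) = z ^ (-j - 1) * v (2 * j + 1 + 1) := fun j => by
    rw [show 2 * j + 1 + 1 = 2 * (j + 1) by ring, χe, show -j - 1 = -(j + 1) - 1 + 1 by ring,
      zpow_add_one₀ hz]
  have M1 : ∀ j : ℤ, conj (α (2 * j + 1)) * ψ (2 * j + 1) + r * ψ (2 * j + 1 + 1)
      = χ (2 * j + 1) := fun j => by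
    refine mul_right_cancel₀ hz ?_
    linear_combination z * conj (α (2 * j + 1)) * ψo j + r * ψs j - z * χo j
      + z ^ (-j - 1) * hu (2 * j + 1)
  have M2 : ∀ j : ℤ, r * ψ (2 * j + 1) - α (2 * j + 1) * ψ (2 * j + 1 + 1)
      = χ (2 * j + 1 + 1) := fun j => by
    refine mul_left_cancel₀ hr ?_
    linear_combination (ψ (2 * j + 1)) * hr2 (2 * j + 1) - α (2 * j + 1) * M1 j - r * χs j
      - z ^ (-j - 1) * hv (2 * j + 1) + ψo j - α (2 * j + 1) * χo j
  have L1 : ∀ j : ℤ, conj (α (2 * j)) * χ (2 * j) + r * χ (2 * j + 1)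
      = z * ψ (2 * j) := fun j => by
    linear_combination conj (α (2 * j)) * χe j + r * χo j - z * ψe j + z ^ (-j - 1) * hu (2 * j)
  have L2 : ∀ j : ℤ, r * χ (2 * j) - α (2 * j) * χ (2 * j + 1)
      = z * ψ (2 * j + 1) := fun j => by
    refine mul_left_cancel₀ hr ?_
    linear_combination (χ (2 * j)) * hr2 (2 * j) - α (2 * j) * L1 j - r * z * ψo j
      - z ^ (-j - 1) * z * hv (2 * j) + χe j - z * α (2 * j) * ψe j
  refine ⟨ψ, χ, fun n => ?_, fun n => ?_, fun n => ?_⟩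
  · obtain ⟨j, rfl | rfl⟩ := n.even_or_odd'
    · have h := M2 (j - 1)
      rw [show 2 * (j - 1) + 1 + 1 = 2 * j by ring, show 2 * (j - 1) + 1 = 2 * j - 1 by ring] at h
      rw [blockMul, if_neg (by simp), hρ]
      exact h
    · simpa [blockMul, hρ] using M1 j
  · obtain ⟨j, rfl | rfl⟩ := n.even_or_odd'
    · simpa [blockMul, hρ] using L1 j
    · rw [blockMul, if_neg (by simp), hρ, add_sub_cancel_right]
      exact L2 j
  · obtain ⟨j, rfl | rfl⟩ := n.even_or_odd'
    · exact ⟨-j - 1, -j, Or.inl ⟨ψe j, by rw [χe, ← zpow_add_one₀ hz, sub_add_cancel]⟩⟩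
    · exact ⟨-j - 1, -j - 1, Or.inr ⟨ψo j, χo j⟩⟩

theorem e_add (s t : ℝ) : e (s + t) = e s * e t := by
  rw [e, e, e, ← Complex.exp_add]
  push_cast
  ring_nf

theorem e_eq_exp_ofReal_mul_I (s : ℝ) : e s = Complex.exp ((2 * Real.pi * s : ℝ) * Complex.I) := by
  rw [e]; push_cast; ring_nf

theorem norm_e (s : ℝ) : ‖e s‖ = 1 := by
  rw [e_eq_exp_ofReal_mul_I]; exact Complex.norm_exp_ofReal_mul_I _

theorem e_ne_zero (s : ℝ) : e s ≠ 0 := Complex.exp_ne_zero _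

theorem conj_e (s : ℝ) : conj (e s) = e (-s) := by
  rw [e, e, ← Complex.exp_conj]
  simp [Complex.conj_ofNat]

theorem e_intCast_mul (s : ℝ) (n : ℤ) : e (n * s) = e s ^ n := by
  rw [e, e, ← Complex.exp_int_mul]
  push_cast
  ring_nf

theorem e_natCast_mul (s : ℝ) (n : ℕ) : e (n * s) = e s ^ n := by
  exact_mod_cast e_intCast_mul s n

theorem e_zero : e 0 = 1 := by simp [e]

theorem e_intCast (n : ℤ) : e n = 1 := by
  have := e_intCast_mul 1 n
  rw [mul_one] at this
  rw [this, e]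
  simp

theorem e_half : e (1 / 2) = -1 := by
  rw [e, ← Complex.exp_pi_mul_I]; push_cast; ring_nf

/-- Localized solutions, for the quadratic phase coefficients, of the transfer matrix recursion at
the spectral parameter attached to the site `0`. -/
theorem exists_localized_transfer {ω : ℝ} {τ c : ℝ} (hc : 0 < c)
    (hω : ∀ m : ℕ, 1 ≤ m → c ≤ (m : ℝ) ^ τ * ‖1 - e (-2 * ω) ^ m‖)
    {lam : ℂ} (hlam0 : lam ≠ 0) {r : ℝ} (hr : |r| < 1) (hr2 : (r * r : ℂ) = 1 - conj lam * lam) :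
    ∃ (u v : ℤ → ℂ) (C t : ℝ), 0 < t ∧ t < 1 ∧ (∀ n, ‖u n‖ ≤ C * t ^ n.natAbs) ∧
      (∀ n, ‖v n‖ ≤ C * t ^ n.natAbs) ∧
      (∀ n : ℤ, r * u (n + 1) = e (1 / 2 + 2 * ω + n * (2 * ω)) * (u n - conj lam * v n)) ∧
      (∀ n : ℤ, r * v (n + 1) = v n - lam * u n) ∧ ∃ n, v n ≠ 0 := by
  obtain ⟨v, C, t, ht0, ht1, hC, hv, hne⟩ := exists_localized_solution (norm_e _) hc hω
    (κ := (r : ℂ)) (by rwa [Complex.norm_real, Real.norm_eq_abs])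
  have hC0 : 0 ≤ C := by simpa using (norm_nonneg _).trans (hC 0)
  have hl : 0 < ‖lam‖ := norm_pos_iff.2 hlam0
  have hshift : ∀ n : ℤ, t ^ (n + 1).natAbs ≤ t⁻¹ * t ^ n.natAbs := fun n => by
    rw [← div_eq_inv_mul, le_div_iff₀ ht0, ← pow_succ]
    exact pow_le_pow_of_le_one ht0.le ht1.le (by omega)
  have hvs : ∀ n, ‖v (n + 1)‖ ≤ C * t⁻¹ * t ^ n.natAbs := fun n => by
    rw [mul_assoc]
    exact (hC _).trans (mul_le_mul_of_nonneg_left (hshift n) hC0)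
  let D := C + (C + C * t⁻¹) / ‖lam‖
  refine ⟨fun n => (v n - r * v (n + 1)) / lam, v, D, t, ht0, ht1, fun n => ?_,
    fun n => ?_, fun n => ?_, fun n => ?_, hne⟩
  · have h : ‖v n - r * v (n + 1)‖ ≤ (C + C * t⁻¹) * t ^ n.natAbs := by
      refine (norm_sub_le _ _).trans ?_
      rw [norm_mul, Complex.norm_real, Real.norm_eq_abs, add_mul]
      refine add_le_add (hC n) ?_
      nlinarith [norm_nonneg (v (n + 1)), hvs n]
    rw [norm_div]
    calc ‖v n - r * v (n + 1)‖ / ‖lam‖ ≤ (C + C * t⁻¹) * t ^ n.natAbs / ‖lam‖ := by gcongr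
      _ = (C + C * t⁻¹) / ‖lam‖ * t ^ n.natAbs := by ring
      _ ≤ D * t ^ n.natAbs := by gcongr; simp [D, hC0]
  · refine (hC n).trans ?_
    gcongr
    have : 0 ≤ (C + C * t⁻¹) / ‖lam‖ := by positivity
    simp only [D]; linarith
  · have h := hv (n + 1)
    have hQ : e (1 / 2 + 2 * ω + n * (2 * ω)) * e (-2 * ω) ^ (n + 1) = -1 := by
      rw [← e_intCast_mul, ← e_add, ← e_half]
      push_cast
      ring_nf
    have hw := e_ne_zero (1 / 2 + 2 * ω + n * (2 * ω))
    rw [add_sub_cancel_right] at h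
    set w := e (1 / 2 + 2 * ω + n * (2 * ω))
    field_simp
    linear_combination -w * r * h + (v (n+1) - r * v (n + 1 + 1)) * r * hQ + v n * w * hr2
  · field_simp
    ring

theorem norm_toLp_le_card_mul {ι : Type*} [Fintype ι] {w : ι → ℂ} {B : ℝ} (hB : 0 ≤ B)
    (h : ∀ i, ‖w i‖ ≤ B) : ‖WithLp.toLp 2 w‖ ≤ Fintype.card ι * B := by
  rw [EuclideanSpace.norm_eq]
  refine Real.sqrt_le_iff.2 ⟨by positivity, ?_⟩
  calc ∑ i, ‖w i‖ ^ 2 ≤ ∑ _i : ι, B ^ 2 := by gcongr with i; exact h i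
    _ = Fintype.card ι * B ^ 2 := by simp
    _ ≤ (Fintype.card ι : ℝ) ^ 2 * B ^ 2 := by
      gcongr
      exact_mod_cast Nat.le_self_pow two_ne_zero _
    _ = _ := by ring

theorem norm_rho_le_one (α : ℤ → ℂ) (n : ℤ) : ‖rho α n‖ ≤ 1 := by
  rw [rho, Complex.norm_real, Real.norm_eq_abs, abs_of_nonneg (Real.sqrt_nonneg _),
    Real.sqrt_le_one]
  nlinarith [norm_nonneg (α n)]

theorem rho_eq_zero {α : ℤ → ℂ} {n : ℤ} (h : ‖α n‖ = 1) : rho α n = 0 := by simp [rho, h]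

theorem norm_modA_le_one {α : ℤ → ℂ} (hα : ∀ n, ‖α n‖ ≤ 1) (a b : ℤ) {β γ : ℂ} (hβ : ‖β‖ = 1)
    (hγ : ‖γ‖ = 1) (n : ℤ) : ‖modA α a b β γ n‖ ≤ 1 := by
  unfold modA
  split_ifs
  exacts [hβ.le, hγ.le, hα n]

theorem norm_modA_left (α : ℤ → ℂ) (a b : ℤ) {β : ℂ} (γ : ℂ) (hβ : ‖β‖ = 1) :
    ‖modA α a b β γ (a - 1)‖ = 1 := by simpa [modA] using hβ

theorem norm_modA_right (α : ℤ → ℂ) {a b : ℤ} (hab : a ≤ b) (β : ℂ) {γ : ℂ} (hγ : ‖γ‖ = 1) :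
    ‖modA α a b β γ b‖ = 1 := by simpa [modA, show b ≠ a - 1 by omega] using hγ

theorem norm_blockMul_modA_sub_le (p : ℤ → Prop) [DecidablePred p] {α : ℤ → ℂ}
    (hα : ∀ n, ‖α n‖ ≤ 1) {a b : ℤ} {β γ : ℂ} (hβ : ‖β‖ = 1) (hγ : ‖γ‖ = 1) {f : ℤ → ℂ} {B : ℝ}
    (hf : ∀ j, j ≤ a ∨ b ≤ j → ‖f j‖ ≤ B) {i : ℤ} (hi : i ∈ Set.Icc a b) :
    ‖blockMul p (modA α a b β γ) f i - blockMul p α f i‖ ≤ 4 * B := by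
  have hB : 0 ≤ B := (norm_nonneg _).trans (hf a (Or.inl le_rfl))
  have hα' := norm_modA_le_one hα a b hβ hγ
  have hmod : ∀ n, n ≠ a - 1 → n ≠ b → modA α a b β γ n = α n := fun n h1 h2 => by
    simp [modA, h1, h2]
  have hmul : ∀ {s w w' : ℂ}, ‖w‖ ≤ 1 → ‖w'‖ ≤ 1 → ‖s‖ ≤ B → ‖(w - w') * s‖ ≤ 2 * B := by
    intro s w w' h1 h2 h3
    rw [norm_mul]
    exact mul_le_mul ((norm_sub_le _ _).trans (by linarith)) h3 (norm_nonneg _) zero_le_two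
  obtain ⟨hi1, hi2⟩ := hi
  by_cases h : p i
  · rw [blockMul, blockMul, if_pos h, if_pos h]
    rcases eq_or_ne i b with rfl | hib
    · rw [show ∀ a b c d s t : ℂ, a * s + b * t - (c * s + d * t) = (a - c) * s + (b - d) * t by
        intros; ring]
      refine (norm_add_le_of_le (hmul ?_ ?_ (hf _ (by omega)))
        (hmul (norm_rho_le_one _ _) (norm_rho_le_one _ _) (hf _ (by omega)))).trans (by linarith)
      · rw [RCLike.norm_conj]; exact hα' i
      · rw [RCLike.norm_conj]; exact hα i
    · simp only [rho, hmod i (by omega) hib, sub_self, norm_zero]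
      positivity
  · rw [blockMul, blockMul, if_neg h, if_neg h]
    rcases eq_or_ne i a with rfl | hia
    · rw [show ∀ a b c d s t : ℂ, a * s - b * t - (c * s - d * t) = (a - c) * s + (d - b) * t by
        intros; ring]
      exact (norm_add_le_of_le (hmul (norm_rho_le_one _ _) (norm_rho_le_one _ _) (hf _ (by omega)))
        (hmul (hα _) (hα' _) (hf _ (by omega)))).trans (by linarith)
    · simp only [rho, hmod (i - 1) (by omega) (by omega), sub_self, norm_zero]
      positivity

theorem even_add_one_iff (n : ℤ) : Even (n + 1) ↔ ¬ Even n := Int.even_add_one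

theorem odd_add_one_iff (n : ℤ) : Odd (n + 1) ↔ ¬ Odd n := by
  rw [← Int.not_even_iff_odd, ← Int.not_even_iff_odd, Int.even_add_one]

section Finite

variable {α : ℤ → ℂ} {a b : ℤ} {β γ : ℂ}

theorem cmvE_mem_unitaryGroup (hα : ∀ n, ‖α n‖ ≤ 1) (ha : rho α (a - 1) = 0) (hb : rho α b = 0) :
    cmvE α a b ∈ Matrix.unitaryGroup (Set.Icc a b) ℂ := by
  rw [cmvE, subL_eq_blockMatrix, subM_eq_blockMatrix]
  exact mul_mem (blockMatrix_mem_unitaryGroup even_add_one_iff hα ha hb)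
    (blockMatrix_mem_unitaryGroup odd_add_one_iff hα ha hb)

theorem norm_toLp_mulVec {ι : Type*} [Fintype ι] [DecidableEq ι] {U : Matrix ι ι ℂ}
    (hU : U ∈ Matrix.unitaryGroup ι ℂ) (w : ι → ℂ) :
    ‖WithLp.toLp 2 (U *ᵥ w)‖ = ‖WithLp.toLp 2 w‖ := by
  have h : ∀ w : ι → ℂ, ((‖WithLp.toLp 2 w‖ ^ 2 : ℝ) : ℂ) = star w ⬝ᵥ w := fun w => by
    rw [EuclideanSpace.norm_sq_eq, dotProduct]
    push_cast
    refine Finset.sum_congr rfl fun i _ => ?_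
    rw [Pi.star_apply, RCLike.star_def, RCLike.conj_mul]
    rfl
  have h2 : ‖WithLp.toLp 2 (U *ᵥ w)‖ ^ 2 = ‖WithLp.toLp 2 w‖ ^ 2 := by
    have : ((‖WithLp.toLp 2 (U *ᵥ w)‖ ^ 2 : ℝ) : ℂ) = (‖WithLp.toLp 2 w‖ ^ 2 : ℝ) := by
      rw [h, h, Matrix.star_mulVec, Matrix.dotProduct_mulVec, Matrix.vecMul_vecMul,
        ← Matrix.star_eq_conjTranspose, Matrix.mem_unitaryGroup_iff'.1 hU, Matrix.vecMul_one]
    exact_mod_cast this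
  exact (pow_left_inj₀ (norm_nonneg _) (norm_nonneg _) two_ne_zero).1 h2

/-- A generalized eigenvector of the extended CMV matrix which is small at and outside the ends of
`[a, b]` yields an eigenvalue of the finite CMV matrix on `[a, b]`. -/
theorem exists_isRoot_charpoly_cmvE_near (hα : ∀ n, ‖α n‖ ≤ 1) (hab : a ≤ b) (hβ : ‖β‖ = 1)
    (hγ : ‖γ‖ = 1) {ψ χ : ℤ → ℂ} {z : ℂ} (hM : ∀ n, blockMul Odd α ψ n = χ n)
    (hL : ∀ n, blockMul Even α χ n = z * ψ n) {B δ : ℝ}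
    (hψ : ∀ j, j ≤ a ∨ b ≤ j → ‖ψ j‖ ≤ B) (hχ : ∀ j, j ≤ a ∨ b ≤ j → ‖χ j‖ ≤ B)
    (hδ : 0 < δ) {k : ℤ} (hk : k ∈ Set.Icc a b) (hψk : δ ≤ ‖ψ k‖) :
    ∃ μ, (cmvE (modA α a b β γ) a b).charpoly.IsRoot μ ∧
      ‖μ - z‖ ≤ Fintype.card (Set.Icc a b) * (8 * B) / δ := by
  have hB : 0 ≤ B := (norm_nonneg _).trans (hψ a (Or.inl le_rfl))
  set αm := modA α a b β γ with hαm
  have hα' : ∀ n, ‖αm n‖ ≤ 1 := norm_modA_le_one hα a b hβ hγ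
  have ha : rho αm (a - 1) = 0 := rho_eq_zero (norm_modA_left α a b γ hβ)
  have hb : rho αm b = 0 := rho_eq_zero (norm_modA_right α hab β hγ)
  let w : Set.Icc a b → ℂ := fun j => ψ j
  have hwk : δ ≤ ‖WithLp.toLp 2 w‖ := hψk.trans (PiLp.norm_apply_le (WithLp.toLp 2 w) ⟨k, hk⟩)
  refine exists_isRoot_charpoly_near (cmvE_mem_unitaryGroup hα' ha hb) (w := w) ?_ ?_
  · intro h
    have := congrFun h ⟨k, hk⟩
    simp only [w, Pi.zero_apply] at this
    rw [this, norm_zero] at hψk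
    linarith
  · let x : Set.Icc a b → ℂ := fun j => χ j
    have hsplit : cmvE αm a b *ᵥ w - z • w
        = blockMatrix Even αm a b *ᵥ (blockMatrix Odd αm a b *ᵥ w - x)
          + (blockMatrix Even αm a b *ᵥ x - z • w) := by
      rw [cmvE, subL_eq_blockMatrix, subM_eq_blockMatrix, Matrix.mulVec_sub, Matrix.mulVec_mulVec]
      abel
    have h1 : ‖WithLp.toLp 2 (blockMatrix Odd αm a b *ᵥ w - x)‖
        ≤ Fintype.card (Set.Icc a b) * (4 * B) := by
      refine norm_toLp_le_card_mul (by positivity) fun i => ?_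
      rw [blockMatrix_mulVec odd_add_one_iff ha hb]
      simp only [Pi.sub_apply, x, ← hM]
      exact norm_blockMul_modA_sub_le Odd hα hβ hγ hψ i.2
    have h2 : ‖WithLp.toLp 2 (blockMatrix Even αm a b *ᵥ x - z • w)‖
        ≤ Fintype.card (Set.Icc a b) * (4 * B) := by
      refine norm_toLp_le_card_mul (by positivity) fun i => ?_
      rw [blockMatrix_mulVec even_add_one_iff ha hb]
      simp only [Pi.sub_apply, Pi.smul_apply, smul_eq_mul, w, ← hL]
      exact norm_blockMul_modA_sub_le Even hα hβ hγ hχ i.2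
    rw [hsplit, WithLp.toLp_add]
    calc _ ≤ Fintype.card (Set.Icc a b) * (4 * B) + Fintype.card (Set.Icc a b) * (4 * B) := by
          refine norm_add_le_of_le ?_ h2
          rwa [norm_toLp_mulVec (blockMatrix_mem_unitaryGroup even_add_one_iff hα' ha hb)]
      _ = Fintype.card (Set.Icc a b) * (8 * B) / δ * δ := by field_simp; ring
      _ ≤ _ := by gcongr

end Finite

/-- For quadratic phase coefficients, the finite CMV matrix on `{0, …, N - 1}` has an eigenvalue
exponentially close to `e (1 / 2 + 2 ω - x - 2 m ω)` when `m` is far from both ends. -/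
theorem exists_isRoot_charpoly_cmvE_near_phase {ω τ c : ℝ} (hc : 0 < c)
    (hω : ∀ m : ℕ, 1 ≤ m → c ≤ (m : ℝ) ^ τ * ‖1 - e (-2 * ω) ^ m‖)
    {lam : ℂ} (hlam0 : lam ≠ 0) (hlam1 : ‖lam‖ < 1) {x y : ℝ} {α : ℤ → ℂ}
    (hα : ∀ n : ℤ, α n = lam * e (y + (n : ℝ) * x + (n : ℝ) * ((n : ℝ) - 1) * ω)) :
    ∃ (K t : ℝ) (d₀ : ℕ), 0 < t ∧ t < 1 ∧ ∀ (N d : ℕ) (m : ℤ) (β γ : ℂ), ‖β‖ = 1 → ‖γ‖ = 1 →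
      d₀ ≤ d → (d : ℤ) ≤ m → m + d + 1 ≤ N →
      ∃ μ, (cmvE (modA α 0 ((N : ℤ) - 1) β γ) 0 ((N : ℤ) - 1)).charpoly.IsRoot μ ∧
        ‖μ - e (1 / 2 + 2 * ω - x - 2 * m * ω)‖ ≤ K * (N * t ^ d) := by
  have hαn : ∀ n, ‖α n‖ = ‖lam‖ := fun n => by rw [hα, norm_mul, norm_e, mul_one]
  have hα1 : ∀ n, ‖α n‖ ≤ 1 := fun n => (hαn n).trans_le hlam1.le
  obtain ⟨r, hr⟩ : ∃ r : ℝ, r = √(1 - ‖lam‖ ^ 2) := ⟨_, rfl⟩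
  have hρ : ∀ n, rho α n = r := fun n => by rw [rho, hαn, hr]
  have hl0 : 0 < ‖lam‖ := norm_pos_iff.2 hlam0
  have hr0 : 0 < r := hr ▸ Real.sqrt_pos.2 (by nlinarith)
  have hr1 : |r| < 1 := by
    rw [abs_of_pos hr0, hr, Real.sqrt_lt' one_pos]
    nlinarith
  have hr2 : (r * r : ℂ) = 1 - conj lam * lam := by
    have := rho_mul_self (α := fun _ => lam) (n := 0) hlam1.le
    rwa [rho, ← hr] at this
  obtain ⟨u, v, C, t, ht0, ht1, hu, hv, hut, hvt, n₀, hn₀⟩ :=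
    exists_localized_transfer hc hω hlam0 hr1 hr2
  have hC0 : 0 ≤ C := by simpa using (norm_nonneg _).trans (hu 0)
  have hδ : 0 < ‖v n₀‖ / 2 := half_pos (norm_pos_iff.2 hn₀)
  refine ⟨8 * C / (‖v n₀‖ / 2), t, n₀.natAbs + 1, ht0, ht1, ?_⟩
  intro N d m β γ hβ hγ hd hm1 hm2
  set z := e (1 / 2 + 2 * ω - x - 2 * m * ω) with hz
  have hz1 : ‖z‖ = 1 := norm_e _
  let φ : ℤ → ℝ := fun n => y + (n : ℝ) * x + (n : ℝ) * ((n : ℝ) - 1) * ω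
  have hee : ∀ n, e (φ n) * e (-φ n) = 1 := fun n => by rw [← e_add, add_neg_cancel, e_zero]
  have hes : ∀ n : ℤ, e (-φ (n + 1)) * e (1 / 2 + 2 * ω + (n - m : ℤ) * (2 * ω)) = z * e (-φ n) :=
    fun n => by
      rw [hz, ← e_add, ← e_add]
      simp only [φ]
      push_cast
      ring_nf
  obtain ⟨ψ, χ, hM, hL, huv⟩ := exists_blockMul_of_transfer (α := α) (r := r) (z := z)
    (by exact_mod_cast hr0.ne') (e_ne_zero _) hρ hα1 (u := fun n => e (-φ n) * u (n - m))
    (v := fun n => v (n - m))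
    (fun n => by
      have h := hut (n - m)
      rw [show n - m + 1 = n + 1 - m by ring] at h
      have h2 : conj (α n) = conj lam * e (-φ n) := by rw [hα, map_mul, conj_e]
      rw [h2]
      linear_combination e (-φ (n + 1)) * h + (u (n - m) - conj lam * v (n - m)) * hes n)
    (fun n => by
      have h := hvt (n - m)
      rw [show n - m + 1 = n + 1 - m by ring] at h
      have h2 : α n = lam * e (φ n) := hα n
      rw [h2]
      linear_combination h + lam * u (n - m) * hee n)
  have hbound : ∀ j, ‖ψ j‖ ≤ C * t ^ (j - m).natAbs ∧ ‖χ j‖ ≤ C * t ^ (j - m).natAbs := by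
    intro j
    obtain ⟨k, l, ⟨h1, h2⟩ | ⟨h1, h2⟩⟩ := huv j
    all_goals
      rw [h1, h2]
      simp only [norm_mul, norm_zpow, hz1, norm_e, one_zpow, one_mul]
    exacts [⟨hu _, hv _⟩, ⟨hv _, hu _⟩]
  have hsmall : ∀ j, j ≤ 0 ∨ (N : ℤ) - 1 ≤ j → C * t ^ (j - m).natAbs ≤ C * t ^ d := fun j hj =>
    mul_le_mul_of_nonneg_left (pow_le_pow_of_le_one ht0.le ht1.le (by omega)) hC0
  obtain ⟨k, hk1, hk2, hk⟩ : ∃ k, m + n₀ - 1 ≤ k ∧ k ≤ m + n₀ + 1 ∧ ‖v n₀‖ / 2 ≤ ‖ψ k‖ := by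
    obtain ⟨k, l, ⟨-, h⟩ | ⟨h, -⟩⟩ := huv (m + n₀)
    · have h1 : ‖χ (m + n₀)‖ = ‖v n₀‖ := by
        rw [h, add_sub_cancel_left, norm_mul, norm_zpow, hz1, one_zpow, one_mul]
      by_contra! hcon
      have hn := hcon (m + n₀) (by omega) (by omega)
      have hl := hcon (m + n₀ - 1) (by omega) (by omega)
      have hg := hcon (m + n₀ + 1) (by omega) (by omega)
      have hmul : ∀ {s w : ℂ}, ‖s‖ ≤ 1 → ‖s * w‖ ≤ ‖w‖ := fun hs => by
        rw [norm_mul]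
        exact mul_le_of_le_one_left (norm_nonneg _) hs
      rw [← hM, blockMul] at h1
      split_ifs at h1
      · have := norm_add_le_of_le (hmul (w := ψ (m + n₀)) (s := conj (α (m + n₀)))
          (by rw [RCLike.norm_conj]; exact hα1 _))
          (hmul (w := ψ (m + n₀ + 1)) (norm_rho_le_one α (m + n₀)))
        linarith
      · have := norm_sub_le_of_le (hmul (w := ψ (m + n₀ - 1)) (norm_rho_le_one α (m + n₀ - 1)))
          (hmul (w := ψ (m + n₀)) (hα1 (m + n₀ - 1)))
        linarith
    · refine ⟨m + n₀, by omega, by omega, ?_⟩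
      rw [h, add_sub_cancel_left, norm_mul, norm_zpow, hz1, one_zpow, one_mul]
      linarith
  obtain ⟨μ, hμ, hμz⟩ := exists_isRoot_charpoly_cmvE_near (b := (N : ℤ) - 1) hα1 (by omega) hβ hγ
    hM hL (fun j hj => (hbound j).1.trans (hsmall j hj))
    (fun j hj => (hbound j).2.trans (hsmall j hj)) hδ (k := k) ⟨by omega, by omega⟩ hk
  refine ⟨μ, hμ, hμz.trans_eq ?_⟩
  rw [show Fintype.card (Set.Icc (0 : ℤ) (N - 1)) = N by simp]
  ring

theorem four_mul_abs_sub_round_le (s : ℝ) : 4 * |s - round s| ≤ ‖e s - 1‖ := by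
  set x := s - round s with hx
  have h1 : e s = e x := by
    rw [← mul_one (e x), ← e_intCast (round s), ← e_add, hx, sub_add_cancel]
  have h2 : |x| ≤ 1 / 2 := abs_sub_round s
  have h3 : |Real.pi * x| ≤ Real.pi / 2 := by
    rw [abs_mul, abs_of_pos Real.pi_pos]
    nlinarith [Real.pi_pos]
  have h4 := Real.mul_abs_le_abs_sin h3
  rw [h1, e_eq_exp_ofReal_mul_I, mul_comm _ Complex.I, Complex.norm_exp_I_mul_ofReal_sub_one,
    norm_mul, Real.norm_eq_abs, Real.norm_eq_abs, abs_two,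
    show 2 * Real.pi * x / 2 = Real.pi * x by ring]
  rw [abs_mul, abs_of_pos Real.pi_pos, ← mul_assoc, div_mul_cancel₀ _ Real.pi_ne_zero] at h4
  linarith

theorem exists_e_eq {z : ℂ} (hz : ‖z‖ = 1) : ∃ s : ℝ, e s = z := by
  refine ⟨z.arg / (2 * Real.pi), ?_⟩
  rw [e_eq_exp_ofReal_mul_I, mul_div_cancel₀ _ (by positivity)]
  simpa [hz] using Complex.norm_mul_exp_arg_mul_I z

theorem le_rpow_mul_norm_one_sub_e_pow {τ ω c : ℝ}
    (h : ∀ q : ℤ, 1 ≤ q → c ≤ (q : ℝ) ^ τ * |(q : ℝ) * ω - round ((q : ℝ) * ω)|)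
    (m : ℕ) (hm : 1 ≤ m) : 4 * c / 2 ^ τ ≤ (m : ℝ) ^ τ * ‖1 - e (-2 * ω) ^ m‖ := by
  have h1 := h (2 * m) (by omega)
  push_cast at h1
  rw [Real.mul_rpow zero_le_two (Nat.cast_nonneg m)] at h1
  have h2 := four_mul_abs_sub_round_le (2 * m * ω)
  have h3 : ‖1 - e (-2 * ω) ^ m‖ = ‖e (2 * m * ω) - 1‖ := by
    rw [← one_mul ‖1 - _‖, ← norm_e (2 * m * ω), ← norm_mul, mul_sub, mul_one, ← e_natCast_mul,
      ← e_add, show 2 * (m : ℝ) * ω + m * (-2 * ω) = 0 by ring, e_zero]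
  rw [div_le_iff₀ (by positivity), h3]
  have h4 : (0 : ℝ) ≤ 2 ^ τ * (m : ℝ) ^ τ := by positivity
  calc 4 * c ≤ 2 ^ τ * (m : ℝ) ^ τ * (4 * |2 * m * ω - round (2 * (m : ℝ) * ω)|) := by linarith
    _ ≤ 2 ^ τ * (m : ℝ) ^ τ * ‖e (2 * m * ω) - 1‖ := by gcongr
    _ = _ := by ring

/-- The roots of a split monic polynomial can be enumerated so as to extend a given enumeration
of some distinct roots. -/
theorem exists_enum_roots {N : ℕ} {p : Polynomial ℂ} (hp : p.Monic) (hN : p.natDegree = N)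
    {S : Finset (Fin N)} {f : Fin N → ℂ} (hf : ∀ n ∈ S, p.IsRoot (f n)) (hinj : Set.InjOn f S) :
    ∃ g : Fin N → ℂ, p = ∏ n, (Polynomial.X - Polynomial.C (g n)) ∧ ∀ n ∈ S, g n = f n := by
  have hs := IsAlgClosed.splits p
  obtain ⟨l, hl⟩ : ∃ l : List ℂ, (l : Multiset ℂ) = p.roots := ⟨_, p.roots.coe_toList⟩
  have hlen : l.length = N := by
    rw [← hN, hs.natDegree_eq_card_roots, ← hl, Multiset.coe_card]
  subst hlen
  have hprod : p = ∏ n, (Polynomial.X - Polynomial.C (l.get n)) := by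
    conv_lhs => rw [hs.eq_prod_roots_of_monic hp, ← hl]
    rw [← List.prod_ofFn, Multiset.map_coe, Multiset.prod_coe]
    congr 1
    refine List.ext_get (by simp) fun i h1 h2 => by simp
  have hmem : ∀ n ∈ S, ∃ j, l.get j = f n := fun n hn => by
    refine List.mem_iff_get.1 ?_
    rw [← Multiset.mem_coe, hl]
    exact (Polynomial.mem_roots hp.ne_zero).2 (hf n hn)
  choose! j hj using hmem
  obtain ⟨σ, hσ⟩ := Set.MapsTo.exists_equiv_extend_of_card_eq
    (t := (Finset.univ : Finset (Fin l.length))) (s := S) (f := j) (by simp)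
    (fun _ _ => Finset.mem_coe.2 (Finset.mem_univ _))
    (fun m hm n hn h => hinj hm hn (by rw [← hj m hm, ← hj n hn, h]))
  let σ' : Equiv.Perm (Fin l.length) := σ.trans (Equiv.subtypeUnivEquiv Finset.mem_univ)
  refine ⟨fun n => l.get (σ' n), ?_, fun n hn => ?_⟩
  · rw [hprod]
    exact (Equiv.prod_comp σ' fun n => Polynomial.X - Polynomial.C (l.get n)).symm
  · rw [← hj n hn, ← hσ n hn]
    rfl

open scoped Matrix.Norms.L2Operator in
theorem norm_eq_one_of_isRoot_charpoly {ι : Type*} [Fintype ι] [DecidableEq ι] {U : Matrix ι ι ℂ}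
    (hU : U ∈ Matrix.unitaryGroup ι ℂ) {μ : ℂ} (h : U.charpoly.IsRoot μ) : ‖μ‖ = 1 := by
  have := Unitary.spectrum_subset_circle (⟨U, hU⟩ : unitary (Matrix ι ι ℂ))
    (Matrix.mem_spectrum_iff_isRoot_charpoly.2 h)
  simpa using this

theorem eventually_mul_pow_sqrt_le (K : ℝ) {t : ℝ} (ht0 : 0 < t) (ht1 : t < 1) (s : ℕ) {η : ℝ}
    (hη : 0 < η) : ∀ᶠ N : ℕ in Filter.atTop, K * (N * t ^ N.sqrt) ≤ η / N ^ s := by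
  have h1 := (tendsto_pow_const_mul_const_pow_of_abs_lt_one (2 * (s + 1))
    (by rwa [abs_of_pos ht0] : |t| < 1)).comp (Filter.tendsto_add_atTop_nat 1)
  have h2 := (h1.const_mul (|K| * t⁻¹)).comp
    (Filter.tendsto_atTop_atTop.2 fun b =>
      ⟨b * b, fun n hn => Nat.le_sqrt.2 hn⟩ : Filter.Tendsto Nat.sqrt Filter.atTop Filter.atTop)
  rw [mul_zero] at h2
  filter_upwards [h2.eventually_lt_const hη, Filter.eventually_ge_atTop 1] with N hN hN1
  simp only [Function.comp_apply] at hN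
  have hNpos : (0 : ℝ) < N := by exact_mod_cast hN1
  rw [le_div_iff₀ (by positivity)]
  refine le_trans ?_ hN.le
  have hsq : (N : ℝ) ≤ ((N.sqrt + 1 : ℕ) : ℝ) ^ 2 := by
    rw [sq]; exact_mod_cast (Nat.lt_succ_sqrt N).le
  calc K * (N * t ^ N.sqrt) * N ^ s ≤ |K| * (N * t ^ N.sqrt) * N ^ s := by
        gcongr; exact le_abs_self K
    _ = |K| * t⁻¹ * ((N : ℝ) ^ (s + 1) * t ^ (N.sqrt + 1)) := by field_simp; ring
    _ ≤ |K| * t⁻¹ * ((((N.sqrt + 1 : ℕ) : ℝ) ^ 2) ^ (s + 1) * t ^ (N.sqrt + 1)) := by gcongr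
    _ = _ := by rw [← pow_mul]

theorem le_mul_norm_e_sub_e {τ ω c : ℝ} (hτ : 0 ≤ τ)
    (hω : ∀ m : ℕ, 1 ≤ m → c ≤ (m : ℝ) ^ τ * ‖1 - e (-2 * ω) ^ m‖) {N : ℕ} (a : ℝ)
    {m n : ℕ} (hn : n < N) (hmn : m < n) :
    c ≤ (N : ℝ) ^ τ * ‖e (a - 2 * m * ω) - e (a - 2 * n * ω)‖ := by
  have h1 : ‖e (a - 2 * m * ω) - e (a - 2 * n * ω)‖ = ‖1 - e (-2 * ω) ^ (n - m)‖ := by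
    have h : e (a - 2 * n * ω) = e (a - 2 * m * ω) * e (-2 * ω) ^ (n - m) := by
      rw [← e_natCast_mul, ← e_add, Nat.cast_sub hmn.le]
      ring_nf
    rw [h, ← mul_one_sub, norm_mul, norm_e, one_mul]
  rw [h1]
  refine (hω (n - m) (by omega)).trans ?_
  gcongr
  omega

theorem card_lt_or_lt_add_le (N d : ℕ) :
    (Finset.univ.filter fun n : Fin N => ¬ (d ≤ n.1 ∧ n.1 + d + 1 ≤ N)).card ≤ 2 * d := by
  rw [← Finset.card_map Fin.valEmbedding]
  refine (Finset.card_le_card (t := Finset.range d ∪ Finset.Ico (N - d) N) fun k hk => ?_).trans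
    ((Finset.card_union_le _ _).trans ?_)
  · simp only [Finset.mem_map, Finset.mem_filter, Finset.mem_univ, true_and,
      Fin.valEmbedding_apply] at hk
    obtain ⟨n, hn, rfl⟩ := hk
    simp only [Finset.mem_union, Finset.mem_range, Finset.mem_Ico]
    omega
  · simp only [Finset.card_range, Nat.card_Ico]
    omega

theorem two_mul_sqrt_div_le {N : ℕ} (hN : 16 ≤ N) :
    ((2 * N.sqrt : ℕ) : ℝ) / N ≤ (N : ℝ) ^ (-(1 / 4) : ℝ) := by
  have hN' : (16 : ℝ) ≤ N := by exact_mod_cast hN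
  have hN0 : (0 : ℝ) < N := by linarith
  have h1 : (N.sqrt : ℝ) ≤ (N : ℝ) ^ (1 / 2 : ℝ) := by
    rw [← Real.sqrt_eq_rpow]
    exact Real.nat_sqrt_le_real_sqrt
  have h2 : (2 : ℝ) ≤ (N : ℝ) ^ (1 / 4 : ℝ) := by
    calc (2 : ℝ) = (16 : ℝ) ^ (1 / 4 : ℝ) := by
          rw [show (16 : ℝ) = 2 ^ (4 : ℝ) by norm_num, ← Real.rpow_mul zero_le_two]
          norm_num
      _ ≤ _ := by gcongr
  rw [div_le_iff₀ hN0]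
  calc ((2 * N.sqrt : ℕ) : ℝ) = 2 * N.sqrt := by push_cast; rfl
    _ ≤ (N : ℝ) ^ (1 / 4 : ℝ) * (N : ℝ) ^ (1 / 2 : ℝ) := by gcongr
    _ = (N : ℝ) ^ (-(1 / 4) : ℝ) * (N : ℝ) ^ (1 : ℝ) := by
      rw [← Real.rpow_add hN0, ← Real.rpow_add hN0]; norm_num
    _ = _ := by rw [Real.rpow_one]

end CMV

/-- For Diophantine `ω`, quadratic-phase Verblunsky coefficients
`α_n = λ e(y + nx + n(n−1)ω)`, and any boundary values `β, γ ∈ ∂𝔻`, there is `σ > 0`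
such that for all large `N` the eigenvalues `e(θ_1), …, e(θ_N)` of the finite CMV matrix
`ℰ^{[0,N−1]}_{β,γ}` satisfy, for some `ϑ`,
`(1/N) #{n : ‖θ_n − ϑ + 2nω‖ > N^{−(1+σ)}} ≤ N^{−σ}`. -/
theorem stmt13 (τ : ℝ) (hτ : 1 < τ) (ω : ℝ)
    (hdio : ∃ c > 0, ∀ q : ℤ, 1 ≤ q →
      c ≤ (q : ℝ) ^ τ * |(q : ℝ) * ω - round ((q : ℝ) * ω)|)
    (lam : ℂ) (hlam0 : lam ≠ 0) (hlam1 : ‖lam‖ < 1)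
    (x y : ℝ) (β γ : ℂ) (hβ : ‖β‖ = 1) (hγ : ‖γ‖ = 1)
    (α : ℤ → ℂ)
    (hα : ∀ n : ℤ, α n = lam * e (y + (n : ℝ) * x + (n : ℝ) * ((n : ℝ) - 1) * ω)) :
    ∃ σ > (0 : ℝ), ∃ N₀ : ℕ, ∀ N : ℕ, N₀ ≤ N →
      ∃ (θ : Fin N → ℝ) (ϑ : ℝ),
        (cmvE (modA α 0 ((N : ℤ) - 1) β γ) 0 ((N : ℤ) - 1)).charpoly
          = ∏ n : Fin N, (Polynomial.X - Polynomial.C (e (θ n))) ∧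
        ((Finset.univ.filter fun n : Fin N =>
            (N : ℝ) ^ (-(1 + σ)) <
              |θ n - ϑ + 2 * ((n : ℕ) + 1) * ω -
                round (θ n - ϑ + 2 * ((n : ℕ) + 1) * ω)|).card : ℝ) / N
          ≤ (N : ℝ) ^ (-σ) := by
  obtain ⟨c₀, hc₀, hdio⟩ := hdio
  have hτ0 : 0 ≤ τ := by linarith
  obtain ⟨c, hc, hω⟩ : ∃ c > 0, ∀ m : ℕ, 1 ≤ m → c ≤ (m : ℝ) ^ τ * ‖1 - e (-2 * ω) ^ m‖ :=
    ⟨_, by positivity, le_rpow_mul_norm_one_sub_e_pow hdio⟩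
  obtain ⟨K, t, d₀, ht0, ht1, hnear⟩ :=
    exists_isRoot_charpoly_cmvE_near_phase hc hω hlam0 hlam1 hα
  obtain ⟨s, hs⟩ := exists_nat_ge (max τ 2)
  obtain ⟨N₀, hN₀⟩ := Filter.eventually_atTop.1 (eventually_mul_pow_sqrt_le K ht0 ht1 s
    (η := min 4 (c / 3)) (by positivity))
  refine ⟨1 / 4, by norm_num, max N₀ (max 16 (d₀ * d₀)), fun N hN => ?_⟩
  simp only [max_le_iff] at hN hs
  obtain ⟨hNN₀, hN16, hNd⟩ := hN
  have hN1 : (1 : ℝ) ≤ N := by exact_mod_cast (by omega : 1 ≤ N)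
  have hNpos : (0 : ℝ) < N := by linarith
  have hε := hN₀ N hNN₀
  set ε := K * (N * t ^ N.sqrt)
  have hε4 : ε ≤ 4 * (N : ℝ) ^ (-(1 + 1 / 4) : ℝ) := by
    refine hε.trans ?_
    rw [div_eq_mul_inv, ← Real.rpow_natCast, ← Real.rpow_neg hNpos.le]
    gcongr
    · exact min_le_left _ _
    · linarith
  have hεc : 2 * ε * (N : ℝ) ^ τ < c := by
    have h1 : (N : ℝ) ^ τ ≤ (N : ℝ) ^ s := by
      rw [← Real.rpow_natCast]
      exact Real.rpow_le_rpow_of_exponent_le hN1 hs.1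
    calc 2 * ε * (N : ℝ) ^ τ ≤ 2 * (c / 3 / (N : ℝ) ^ s) * (N : ℝ) ^ τ := by
          gcongr
          exact hε.trans (by gcongr; exact min_le_right _ _)
      _ ≤ 2 * (c / 3 / (N : ℝ) ^ s) * (N : ℝ) ^ s := by gcongr
      _ = 2 * (c / 3) := by field_simp
      _ < c := by linarith
  set p := (cmvE (modA α 0 ((N : ℤ) - 1) β γ) 0 ((N : ℤ) - 1)).charpoly with hp
  let S : Finset (Fin N) := Finset.univ.filter fun n => N.sqrt ≤ n.1 ∧ n.1 + N.sqrt + 1 ≤ N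
  have hroot : ∀ n ∈ S, ∃ μ, p.IsRoot μ ∧
      ‖μ - e (1 / 2 + 2 * ω - x - 2 * (n : ℕ) * ω)‖ ≤ ε := by
    intro n hn
    obtain ⟨hn1, hn2⟩ := (Finset.mem_filter.1 hn).2
    exact_mod_cast hnear N N.sqrt (n : ℕ) β γ hβ hγ (Nat.le_sqrt.2 hNd) (by omega) (by omega)
  choose! f hf hfε using hroot
  have hsep : ∀ m ∈ S, ∀ n ∈ S, m < n → f m ≠ f n := by
    intro m hm n hn hmn heq
    have h1 := le_mul_norm_e_sub_e hτ0 hω (1 / 2 + 2 * ω - x) n.2 hmn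
    have h2 : ‖e (1 / 2 + 2 * ω - x - 2 * (m : ℕ) * ω)
        - e (1 / 2 + 2 * ω - x - 2 * (n : ℕ) * ω)‖ ≤ 2 * ε := by
      rw [← sub_sub_sub_cancel_left _ _ (f n)]
      refine (norm_sub_le_of_le (hfε n hn) ?_).trans (two_mul ε).ge
      rw [← heq]
      exact hfε m hm
    have h3 : (N : ℝ) ^ τ * ‖_‖ ≤ (N : ℝ) ^ τ * (2 * ε) :=
      mul_le_mul_of_nonneg_left h2 (by positivity)
    linarith
  have hinj : Set.InjOn f S := by
    intro m hm n hn h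
    rcases lt_trichotomy m n with hmn | hmn | hmn
    · exact absurd h (hsep m hm n hn hmn)
    · exact hmn
    · exact absurd h.symm (hsep n hn m hm hmn)
  obtain ⟨g, hg, hgf⟩ := exists_enum_roots (Matrix.charpoly_monic _)
    (by rw [Matrix.charpoly_natDegree_eq_dim]; simp) hf hinj
  have hα1 : ∀ n, ‖α n‖ ≤ 1 := fun n => by rw [hα, norm_mul, norm_e, mul_one]; exact hlam1.le
  have hU := cmvE_mem_unitaryGroup (norm_modA_le_one hα1 0 ((N : ℤ) - 1) hβ hγ)
    (rho_eq_zero (norm_modA_left α 0 ((N : ℤ) - 1) γ hβ))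
    (rho_eq_zero (norm_modA_right α (by omega) β hγ))
  have hgroot : ∀ n, p.IsRoot (g n) := fun n => by
    rw [hp, hg, Polynomial.IsRoot, Polynomial.eval_prod]
    exact Finset.prod_eq_zero (Finset.mem_univ n) (by simp)
  choose θ hθ using fun n => exists_e_eq (norm_eq_one_of_isRoot_charpoly hU (hgroot n))
  refine ⟨θ, 1 / 2 + 4 * ω - x, by simpa only [hθ] using hg, ?_⟩
  refine le_trans ?_ (two_mul_sqrt_div_le hN16)
  gcongr
  refine (Finset.card_le_card fun n hn => ?_).trans (card_lt_or_lt_add_le N N.sqrt)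
  rw [Finset.mem_filter] at hn ⊢
  refine ⟨Finset.mem_univ n, fun hgood => hn.2.not_ge ?_⟩
  have hnS : n ∈ S := Finset.mem_filter.2 ⟨Finset.mem_univ n, hgood⟩
  have h1 := four_mul_abs_sub_round_le (θ n - (1 / 2 + 4 * ω - x) + 2 * ((n : ℕ) + 1) * ω)
  have h2 : ‖e (θ n - (1 / 2 + 4 * ω - x) + 2 * ((n : ℕ) + 1) * ω) - 1‖
      = ‖f n - e (1 / 2 + 2 * ω - x - 2 * (n : ℕ) * ω)‖ := by
    have h : e (θ n) = e (1 / 2 + 2 * ω - x - 2 * (n : ℕ) * ω)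
        * e (θ n - (1 / 2 + 4 * ω - x) + 2 * ((n : ℕ) + 1) * ω) := by
      rw [← e_add]
      ring_nf
    rw [← hgf n hnS, ← hθ, h, ← mul_sub_one, norm_mul, norm_e, one_mul]
  rw [h2] at h1
  linarith [hfε n hnS]
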